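/- arXiv:2605.21946 — 3 statements merged into one kernel-verified Lean document; each statement's English description precedes it below -/
import Mathlib

section
/- Let A be an n×n Hermitian positive semidefinite matrix of rank d with all diagonal entries nonzero, and let A = V V† where V ∈ ℂ^{n×d} has full column rank and rows v₁,…,vₙ. Define Φ(V) = sup over Hermitian positive definite d×d matrices X of φ_V(X) = ∑_{i=1}^n log(vᵢ† X vᵢ) + log det X − tr X + d, and P̂(A) = exp(Φ(V)). Then e^{−γn} P̂(A) ≤ per(A) ≤ P̂(A), where γ is the Euler–Mascheroni constant. -/
open MeasureTheory Matrix
open scoped ComplexOrder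

/-- The objective `φ_V(X) = ∑ᵢ log(vᵢ† X vᵢ) + log det X − tr X + d` for a Gram factor
`V` with rows `vᵢ` and a Hermitian positive definite matrix `X`. -/
noncomputable def phiV {n d : ℕ} (V : Matrix (Fin n) (Fin d) ℂ)
    (X : Matrix (Fin d) (Fin d) ℂ) : ℝ :=
  (∑ i, Real.log ((star (V i) ⬝ᵥ X *ᵥ V i).re)) + Real.log X.det.re - X.trace.re + d

/-- `Φ(V) = sup_{X ≻ 0} φ_V(X)`. -/
noncomputable def PhiV {n d : ℕ} (V : Matrix (Fin n) (Fin d) ℂ) : ℝ :=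
  sSup {r : ℝ | ∃ X : Matrix (Fin d) (Fin d) ℂ, X.PosDef ∧ r = phiV V X}

open ComplexConjugate in
/-- Mixed moments of the (unnormalised) standard complex Gaussian. -/
theorem integral_pow_mul_conj_pow_mul_gaussian (a b : ℕ) :
    ∫ z : ℂ, z ^ a * (conj z) ^ b * (Real.exp (-‖z‖ ^ 2) : ℂ) =
      if a = b then (Real.pi * a.factorial : ℂ) else 0 := by
  split_ifs with h
  · subst h
    have key := Complex.integral_rpow_mul_exp_neg_rpow (p := 2) (q := 2 * a) (by norm_num)
      (by have : (0 : ℝ) ≤ a := a.cast_nonneg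
          linarith)
    have h2 : ((2 : ℝ) * a + 2) / 2 = a + 1 := by ring
    rw [h2, Real.Gamma_nat_eq_factorial] at key
    have h3 : ∀ z : ℂ, z ^ a * (conj z) ^ a * (Real.exp (-‖z‖ ^ 2) : ℂ) =
        ((‖z‖ ^ ((2 : ℝ) * a) * Real.exp (-‖z‖ ^ (2 : ℝ)) : ℝ) : ℂ) := by
      intro z
      rw [← mul_pow, Complex.mul_conj, Complex.normSq_eq_norm_sq, Real.rpow_mul (norm_nonneg _),
        Real.rpow_natCast, Real.rpow_two]
      push_cast
      ring
    simp_rw [h3]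
    rw [integral_complex_ofReal, key]
    push_cast
    ring
  · set d : ℝ := (a : ℝ) - b with hd
    have hd0 : (d : ℂ) ≠ 0 := by
      rw [hd]
      exact Complex.ofReal_ne_zero.2 (sub_ne_zero.2 (Nat.cast_injective.ne h))
    set c : Circle := Circle.exp (Real.pi / d)
    set I : ℂ := ∫ z : ℂ, z ^ a * (conj z) ^ b * (Real.exp (-‖z‖ ^ 2) : ℂ)
    have hc : (c : ℂ) ^ a * (conj (c : ℂ)) ^ b = -1 := by
      rw [Circle.coe_exp, ← Complex.exp_conj, ← Complex.exp_nat_mul, ← Complex.exp_nat_mul,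
        ← Complex.exp_add, ← Complex.exp_pi_mul_I]
      congr 1
      simp only [map_mul, Complex.conj_ofReal, Complex.conj_I]
      have : (d : ℂ) = (a : ℂ) - b := by rw [hd]; push_cast; ring
      push_cast
      field_simp
      rw [this]; ring
    have h1 : I = -I := by
      have := ((rotation c).measurePreserving).integral_comp
        (rotation c).toHomeomorph.measurableEmbedding
        (fun z : ℂ => z ^ a * (conj z) ^ b * (Real.exp (-‖z‖ ^ 2) : ℂ))
      change _ = I at this
      nth_rewrite 1 [← this]
      rw [← integral_neg]
      refine integral_congr_ae (.of_forall fun z => ?_)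
      simp only [rotation_apply, map_mul, mul_pow, norm_mul, Circle.norm_coe, one_mul]
      linear_combination (z ^ a * conj z ^ b * (Real.exp (-‖z‖ ^ 2) : ℂ)) * hc
    exact self_eq_neg.1 h1

theorem integral_exp_neg_norm_sq : ∫ z : ℂ, Real.exp (-‖z‖ ^ 2) = Real.pi := by
  have := integral_pow_mul_conj_pow_mul_gaussian 0 0
  simp only [pow_zero, one_mul, if_true, Nat.factorial_zero, Nat.cast_one, mul_one] at this
  rw [integral_complex_ofReal] at this
  exact_mod_cast this

theorem integral_log_mul_exp_neg :
    ∫ t in Set.Ioi (0 : ℝ), Real.log t * Real.exp (-t) = -Real.eulerMascheroniConstant := by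
  have h1 := Complex.hasDerivAt_GammaIntegral (s := 1) (by simp)
  have h2 : HasDerivAt Complex.Gamma (-Real.eulerMascheroniConstant : ℂ) 1 :=
    Complex.hasDerivAt_Gamma_one
  have h3 : Complex.Gamma =ᶠ[nhds 1] Complex.GammaIntegral := by
    have : {s : ℂ | 0 < s.re} ∈ nhds (1 : ℂ) :=
      (isOpen_lt continuous_const Complex.continuous_re).mem_nhds (by simp)
    filter_upwards [this] with s hs using Complex.Gamma_eq_integral hs
  have h4 := (h1.congr_of_eventuallyEq h3).unique h2
  simp only [sub_self, Complex.cpow_zero, one_mul] at h4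
  have h5 : ∫ t in Set.Ioi (0 : ℝ), (((Real.log t * Real.exp (-t) : ℝ)) : ℂ) =
      ((-Real.eulerMascheroniConstant : ℝ) : ℂ) := by
    push_cast
    push_cast at h4
    exact h4
  rw [integral_complex_ofReal] at h5
  exact_mod_cast h5

theorem integral_log_norm_sq_mul_exp_neg_norm_sq :
    ∫ z : ℂ, Real.log (‖z‖ ^ 2) * Real.exp (-‖z‖ ^ 2) =
      -(Real.pi * Real.eulerMascheroniConstant) := by
  rw [integral_fun_norm_addHaar volume (fun r : ℝ => Real.log (r ^ 2) * Real.exp (-r ^ 2))]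
  have h := integral_comp_rpow_Ioi (fun t : ℝ => Real.log t * Real.exp (-t)) (p := 2) (by norm_num)
  rw [integral_log_mul_exp_neg] at h
  have h2 : ∫ y in Set.Ioi (0 : ℝ), y ^ (Module.finrank ℝ ℂ - 1) •
      (Real.log (y ^ 2) * Real.exp (-y ^ 2)) = - Real.eulerMascheroniConstant / 2 := by
    rw [← h, div_eq_inv_mul, ← integral_const_mul]
    refine setIntegral_congr_fun measurableSet_Ioi fun y hy => ?_
    have : (2 : ℝ) - 1 = 1 := by norm_num
    simp [Complex.finrank_real_complex, this]
    ring
  rw [h2, Complex.finrank_real_complex, measureReal_def, Complex.volume_ball]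
  simp only [ENNReal.ofReal_one, one_pow, one_mul, ENNReal.coe_toReal, NNReal.coe_real_pi,
    nsmul_eq_mul, smul_eq_mul]
  push_cast
  ring

theorem integrable_log_norm_sq_mul_exp_neg_norm_sq :
    Integrable (fun z : ℂ => Real.log (‖z‖ ^ 2) * Real.exp (-‖z‖ ^ 2)) := by
  refine not_imp_comm.1 integral_undef ?_
  rw [integral_log_norm_sq_mul_exp_neg_norm_sq]
  have := Real.one_half_lt_eulerMascheroniConstant
  exact neg_ne_zero.2 (mul_ne_zero Real.pi_ne_zero (by linarith))

/-- The unnormalised standard Gaussian density on `ℂ^d`. -/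
noncomputable def gaussWeight {d : ℕ} (z : Fin d → ℂ) : ℝ := Real.exp (-∑ k, ‖z k‖ ^ 2)

theorem gaussWeight_pos {d : ℕ} (z : Fin d → ℂ) : 0 < gaussWeight z := Real.exp_pos _

theorem continuous_gaussWeight {d : ℕ} : Continuous (gaussWeight (d := d)) := by
  unfold gaussWeight
  fun_prop

theorem gaussWeight_eq_prod {d : ℕ} (z : Fin d → ℂ) :
    gaussWeight z = ∏ k, Real.exp (-‖z k‖ ^ 2) := by
  rw [gaussWeight, ← Finset.sum_neg_distrib, Real.exp_sum]

theorem integral_gaussWeight {d : ℕ} : ∫ z : Fin d → ℂ, gaussWeight z = Real.pi ^ d := by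
  simp_rw [gaussWeight_eq_prod]
  rw [integral_fintype_prod_volume_eq_pow (fun z : ℂ => Real.exp (-‖z‖ ^ 2)),
    integral_exp_neg_norm_sq, Fintype.card_fin]

/-- Continuous functions on `ℂ^d` of at most polynomial growth. -/
def PolyGrowth {d : ℕ} {E : Type*} [NormedAddCommGroup E] (f : (Fin d → ℂ) → E) : Prop :=
  Continuous f ∧ ∃ (C : ℝ) (m : ℕ), ∀ z, ‖f z‖ ≤ C * (∏ k, (1 + ‖z k‖)) ^ m

namespace PolyGrowth

variable {d : ℕ} {E : Type*} [NormedAddCommGroup E]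

theorem one_le_prod (z : Fin d → ℂ) : 1 ≤ ∏ k, (1 + ‖z k‖) :=
  Finset.one_le_prod fun _ _ => le_add_of_nonneg_right (norm_nonneg _)

theorem const (c : E) : PolyGrowth (fun _ : Fin d → ℂ => c) :=
  ⟨continuous_const, ‖c‖, 0, fun z => by simp⟩

theorem coord (k : Fin d) : PolyGrowth (fun z : Fin d → ℂ => z k) := by
  refine ⟨continuous_apply k, 1, 1, fun z => ?_⟩
  rw [one_mul, pow_one]
  calc ‖z k‖ ≤ 1 + ‖z k‖ := by linarith
    _ = (1 + ‖z k‖) * 1 := (mul_one _).symm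
    _ ≤ (1 + ‖z k‖) * ∏ j ∈ Finset.univ.erase k, (1 + ‖z j‖) := by
      gcongr
      exact Finset.one_le_prod fun _ _ => le_add_of_nonneg_right (norm_nonneg _)
    _ = _ := Finset.mul_prod_erase _ (fun j => 1 + ‖z j‖) (Finset.mem_univ k)

theorem add {f g : (Fin d → ℂ) → E} (hf : PolyGrowth f) (hg : PolyGrowth g) :
    PolyGrowth (fun z => f z + g z) := by
  obtain ⟨hf, C, m, hC⟩ := hf
  obtain ⟨hg, C', m', hC'⟩ := hg
  refine ⟨hf.add hg, |C| + |C'|, m + m', fun z => ?_⟩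
  have h1 := one_le_prod z
  have hm : (∏ k, (1 + ‖z k‖)) ^ m ≤ (∏ k, (1 + ‖z k‖)) ^ (m + m') :=
    pow_le_pow_right₀ h1 (by omega)
  have hm' : (∏ k, (1 + ‖z k‖)) ^ m' ≤ (∏ k, (1 + ‖z k‖)) ^ (m + m') :=
    pow_le_pow_right₀ h1 (by omega)
  calc ‖f z + g z‖ ≤ ‖f z‖ + ‖g z‖ := norm_add_le _ _
    _ ≤ C * (∏ k, (1 + ‖z k‖)) ^ m + C' * (∏ k, (1 + ‖z k‖)) ^ m' := add_le_add (hC z) (hC' z)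
    _ ≤ |C| * (∏ k, (1 + ‖z k‖)) ^ m + |C'| * (∏ k, (1 + ‖z k‖)) ^ m' := by
      gcongr <;> exact le_abs_self _
    _ ≤ |C| * (∏ k, (1 + ‖z k‖)) ^ (m + m') + |C'| * (∏ k, (1 + ‖z k‖)) ^ (m + m') := by
      gcongr
    _ = _ := by ring

theorem mul {R : Type*} [NormedCommRing R] {f g : (Fin d → ℂ) → R}
    (hf : PolyGrowth f) (hg : PolyGrowth g) : PolyGrowth (fun z => f z * g z) := by
  obtain ⟨hf, C, m, hC⟩ := hf
  obtain ⟨hg, C', m', hC'⟩ := hg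
  refine ⟨hf.mul hg, C * C', m + m', fun z => ?_⟩
  calc ‖f z * g z‖ ≤ ‖f z‖ * ‖g z‖ := norm_mul_le _ _
    _ ≤ (C * (∏ k, (1 + ‖z k‖)) ^ m) * (C' * (∏ k, (1 + ‖z k‖)) ^ m') :=
      mul_le_mul (hC z) (hC' z) (norm_nonneg _) ((norm_nonneg _).trans (hC z))
    _ = _ := by ring

theorem sum {ι : Type*} (s : Finset ι) {f : ι → (Fin d → ℂ) → E} (hf : ∀ i, PolyGrowth (f i)) :
    PolyGrowth (fun z => ∑ i ∈ s, f i z) := by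
  classical
  induction s using Finset.induction_on with
  | empty => simpa using const 0
  | insert a s ha ih => simpa [Finset.sum_insert ha] using (hf a).add ih

theorem prod {R : Type*} [NormedCommRing R] {ι : Type*} (s : Finset ι)
    {f : ι → (Fin d → ℂ) → R} (hf : ∀ i, PolyGrowth (f i)) :
    PolyGrowth (fun z => ∏ i ∈ s, f i z) := by
  classical
  induction s using Finset.induction_on with
  | empty => simpa using const 1
  | insert a s ha ih => simpa [Finset.prod_insert ha] using (hf a).mul ih

theorem norm {f : (Fin d → ℂ) → E} (hf : PolyGrowth f) : PolyGrowth (fun z => ‖f z‖) :=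
  ⟨hf.1.norm, by simpa using hf.2⟩

theorem pow {R : Type*} [NormedCommRing R] {f : (Fin d → ℂ) → R} (hf : PolyGrowth f) (n : ℕ) :
    PolyGrowth (fun z => f z ^ n) := by
  simpa using prod (Finset.range n) (fun _ => hf)

theorem conj {f : (Fin d → ℂ) → ℂ} (hf : PolyGrowth f) :
    PolyGrowth (fun z => (starRingEnd ℂ) (f z)) :=
  ⟨Complex.continuous_conj.comp hf.1, by simpa using hf.2⟩

theorem dotProduct (u : Fin d → ℂ) : PolyGrowth (fun z : Fin d → ℂ => u ⬝ᵥ z) :=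
  sum Finset.univ fun k => (const (u k)).mul (coord k)

theorem integrable_one_add_norm_pow (m : ℕ) :
    Integrable (fun z : ℂ => (1 + ‖z‖) ^ m * Real.exp (-‖z‖ ^ 2)) := by
  simp_rw [add_pow, one_pow, one_mul, Finset.sum_mul]
  refine integrable_finsetSum _ fun k _ => ?_
  have : Integrable (fun z : ℂ => ‖z‖ ^ ((m - k : ℕ) : ℝ) * Real.exp (-‖z‖ ^ (2 : ℝ))) := by
    refine not_imp_comm.1 integral_undef ?_
    have h0 : (0 : ℝ) ≤ (m - k : ℕ) := Nat.cast_nonneg _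
    rw [Complex.integral_rpow_mul_exp_neg_rpow (by norm_num) (by linarith)]
    have := Real.Gamma_pos_of_pos (s := ((m - k : ℕ) + 2 : ℝ) / 2) (by linarith)
    have := Real.pi_pos
    positivity
  refine (this.const_mul (m.choose k : ℝ)).congr (.of_forall fun z => ?_)
  simp only [Real.rpow_natCast, Real.rpow_two]
  ring

theorem integrable_mul {f : (Fin d → ℂ) → ℝ} (hf : PolyGrowth f) :
    Integrable (fun z => f z * gaussWeight z) := by
  obtain ⟨hf, C, m, hC⟩ := hf
  have h : Integrable (fun z : Fin d → ℂ => C * ∏ k, ((1 + ‖z k‖) ^ m * Real.exp (-‖z k‖ ^ 2))) :=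
    (Integrable.fintype_prod fun _ => integrable_one_add_norm_pow m).const_mul C
  refine h.mono' (hf.mul continuous_gaussWeight).aestronglyMeasurable (.of_forall fun z => ?_)
  rw [norm_mul, Real.norm_of_nonneg (gaussWeight_pos z).le, Finset.prod_mul_distrib,
    Finset.prod_pow, ← gaussWeight_eq_prod, ← mul_assoc]
  exact mul_le_mul_of_nonneg_right (hC z) (gaussWeight_pos z).le

theorem integrable_mul_ofReal {f : (Fin d → ℂ) → ℂ} (hf : PolyGrowth f) :
    Integrable (fun z => f z * (gaussWeight z : ℂ)) := by
  refine hf.norm.integrable_mul.mono'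
    (hf.1.mul (Complex.continuous_ofReal.comp continuous_gaussWeight)).aestronglyMeasurable
    (.of_forall fun z => ?_)
  rw [norm_mul, Complex.norm_real, Real.norm_of_nonneg (gaussWeight_pos z).le]

end PolyGrowth

theorem card_comp_perm_eq {n d : ℕ} (f g : Fin n → Fin d) :
    Fintype.card {σ : Equiv.Perm (Fin n) // f ∘ σ = g} =
      ∏ k, if Fintype.card {i // f i = k} = Fintype.card {i // g i = k}
        then (Fintype.card {i // f i = k}).factorial else 0 := by
  by_cases h : ∀ k, Fintype.card {i // f i = k} = Fintype.card {i // g i = k}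
  · simp only [h, if_true]
    let τ : Equiv.Perm (Fin n) :=
      Equiv.ofFiberEquiv (f := g) (g := f) fun k => Fintype.equivOfCardEq (h k).symm
    have hτ : f ∘ τ = g := funext fun i => Equiv.ofFiberEquiv_map _ i
    rw [← DomMulAct.stabilizer_card g]
    refine Fintype.card_congr ((Equiv.mulLeft τ⁻¹).subtypeEquiv fun σ => ?_)
    rw [← hτ]
    constructor
    · intro hσ
      funext i
      have := congrFun hσ i
      simp only [Function.comp_apply] at this
      simp [this]
    · intro hσ
      funext i
      have := congrFun hσ i
      simp only [Function.comp_apply, Equiv.coe_mulLeft, Equiv.Perm.mul_apply,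
        Equiv.Perm.inv_def,
        Equiv.apply_symm_apply] at this
      simp [this]
  · push Not at h
    obtain ⟨k, hk⟩ := h
    rw [Finset.prod_eq_zero (Finset.mem_univ k) (if_neg hk), Fintype.card_eq_zero_iff]
    refine ⟨fun ⟨σ, hσ⟩ => hk (Fintype.card_congr ?_)⟩
    subst hσ
    exact (σ.subtypeEquiv fun i => Iff.rfl).symm

open ComplexConjugate in
theorem integral_monomial_gaussWeight {n d : ℕ} (f g : Fin n → Fin d) :
    ∫ z : Fin d → ℂ, (∏ i, z (f i)) * (∏ i, conj (z (g i))) * (gaussWeight z : ℂ) =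
      Real.pi ^ d * Fintype.card {σ : Equiv.Perm (Fin n) // f ∘ σ = g} := by
  have h : ∀ (x : Fin d → ℂ) (f : Fin n → Fin d),
      ∏ i, x (f i) = ∏ k, x k ^ Fintype.card {i // f i = k} := by
    intro x f
    rw [← Fintype.prod_fiberwise' f x]
    simp
  have h' : ∀ z : Fin d → ℂ, (∏ i, z (f i)) * (∏ i, conj (z (g i))) * (gaussWeight z : ℂ) =
      ∏ k, (z k ^ Fintype.card {i // f i = k} * conj (z k) ^ Fintype.card {i // g i = k} *
        (Real.exp (-‖z k‖ ^ 2) : ℂ)) := by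
    intro z
    rw [h z f, h (fun k => conj (z k)) g, gaussWeight_eq_prod, Complex.ofReal_prod,
      Finset.prod_mul_distrib, Finset.prod_mul_distrib]
  simp_rw [h']
  rw [integral_fintype_prod_volume_eq_prod (fun k (w : ℂ) =>
    w ^ Fintype.card {i // f i = k} * conj w ^ Fintype.card {i // g i = k} *
      (Real.exp (-‖w‖ ^ 2) : ℂ))]
  simp_rw [integral_pow_mul_conj_pow_mul_gaussian]
  rw [card_comp_perm_eq, Nat.cast_prod]
  have hpi : (Real.pi : ℂ) ^ d = ∏ _k : Fin d, (Real.pi : ℂ) := by simp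
  rw [hpi, ← Finset.prod_mul_distrib]
  refine Finset.prod_congr rfl fun k _ => ?_
  split_ifs <;> simp

open ComplexConjugate in
/-- Wick's formula for products of linear forms. -/
theorem integral_wick {n d : ℕ} (a b : Fin n → Fin d → ℂ) :
    ∫ z : Fin d → ℂ, (∏ i, (∑ k, a i k * z k)) * (∏ i, (∑ k, b i k * conj (z k))) *
        (gaussWeight z : ℂ) =
      Real.pi ^ d * ∑ σ : Equiv.Perm (Fin n), ∏ i, ∑ k, a (σ i) k * b i k := by
  have expand : ∀ z : Fin d → ℂ, (∏ i, (∑ k, a i k * z k)) * (∏ i, (∑ k, b i k * conj (z k))) *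
        (gaussWeight z : ℂ) = ∑ f : Fin n → Fin d, ∑ g : Fin n → Fin d,
        ((∏ i, a i (f i)) * ∏ i, b i (g i)) *
          ((∏ i, z (f i)) * (∏ i, conj (z (g i))) * (gaussWeight z : ℂ)) := by
    intro z
    simp only [Finset.prod_univ_sum, Fintype.piFinset_univ, Finset.prod_mul_distrib,
      Finset.sum_mul_sum]
    simp only [Finset.sum_mul]
    refine Finset.sum_congr rfl fun f _ => Finset.sum_congr rfl fun g _ => ?_
    ring
  have hint : ∀ f g : Fin n → Fin d, Integrable fun z : Fin d → ℂ =>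
      ((∏ i, a i (f i)) * ∏ i, b i (g i)) *
          ((∏ i, z (f i)) * (∏ i, conj (z (g i))) * (gaussWeight z : ℂ)) := fun f g =>
    (((PolyGrowth.prod _ fun i => PolyGrowth.coord (f i)).mul
      (PolyGrowth.prod _ fun i => (PolyGrowth.coord (g i)).conj)).integrable_mul_ofReal).const_mul _
  simp_rw [expand]
  rw [integral_finsetSum _ fun f _ => integrable_finsetSum _ fun g _ => hint f g]
  simp_rw [integral_finsetSum _ fun g _ => hint _ g, integral_const_mul,
    integral_monomial_gaussWeight]
  have hcard : ∀ f g : Fin n → Fin d,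
      (Fintype.card {σ : Equiv.Perm (Fin n) // f ∘ σ = g} : ℂ) =
        ∑ σ : Equiv.Perm (Fin n), if f = g ∘ ⇑σ⁻¹ then 1 else 0 := by
    intro f g
    rw [Fintype.card_subtype, Finset.card_filter]
    push_cast
    refine Finset.sum_congr rfl fun σ _ => ?_
    congr 1
    rw [eq_iff_iff]
    exact (Equiv.eq_comp_symm σ f g).symm
  simp_rw [hcard]
  rw [Finset.sum_comm]
  simp_rw [Finset.mul_sum, Finset.prod_univ_sum, Fintype.piFinset_univ, Finset.mul_sum]
  rw [Finset.sum_comm (s := Finset.univ (α := Equiv.Perm (Fin n)))]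
  refine Finset.sum_congr rfl fun g _ => ?_
  rw [Finset.sum_comm]
  refine Finset.sum_congr rfl fun σ _ => ?_
  simp only [mul_ite, mul_one, mul_zero, Finset.sum_ite_eq', Finset.mem_univ, if_true]
  rw [← Equiv.prod_comp σ (fun i => a i ((g ∘ ⇑σ⁻¹) i))]
  simp only [Function.comp_apply, Equiv.Perm.inv_def, Equiv.symm_apply_apply,
    Finset.prod_mul_distrib]
  ring

theorem integral_norm_sq_dotProduct_mul_gaussWeight {d : ℕ} (u : Fin d → ℂ) :
    ∫ z : Fin d → ℂ, ‖u ⬝ᵥ z‖ ^ 2 * gaussWeight z = Real.pi ^ d * ∑ k, ‖u k‖ ^ 2 := by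
  have h := integral_wick (n := 1) (fun _ => u) (fun _ k => star (u k))
  have h1 : ∀ z : Fin d → ℂ, (∏ _i : Fin 1, (∑ k, u k * z k)) *
      (∏ _i : Fin 1, (∑ k, star (u k) * (starRingEnd ℂ) (z k))) * (gaussWeight z : ℂ) =
      ((‖u ⬝ᵥ z‖ ^ 2 * gaussWeight z : ℝ) : ℂ) := by
    intro z
    have : ∑ k, star (u k) * (starRingEnd ℂ) (z k) = (starRingEnd ℂ) (u ⬝ᵥ z) := by
      simp [dotProduct]
    rw [this]
    simp only [Finset.univ_unique, Finset.prod_const, Finset.card_singleton, pow_one]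
    rw [← dotProduct, Complex.mul_conj, Complex.normSq_eq_norm_sq]
    push_cast
    rfl
  simp_rw [h1] at h
  rw [integral_complex_ofReal] at h
  have h2 : ∀ k, u k * star (u k) = ((‖u k‖ ^ 2 : ℝ) : ℂ) := fun k => by
    rw [Complex.star_def, Complex.mul_conj, Complex.normSq_eq_norm_sq]
  simp only [Finset.univ_unique, Finset.prod_const, Finset.card_singleton, pow_one, h2,
    Finset.sum_const, one_smul] at h
  exact_mod_cast h

theorem map_mulVec_volume {d : ℕ} (Y : Matrix (Fin d) (Fin d) ℂ) (hY : Y.det ≠ 0) :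
    Measure.map (fun w : Fin d → ℂ => Y *ᵥ w) volume =
      ENNReal.ofReal (‖Y.det‖ ^ 2)⁻¹ • (volume : Measure (Fin d → ℂ)) := by
  have hdet : LinearMap.det ((Matrix.toLin' Y).restrictScalars ℝ) = ‖Y.det‖ ^ 2 := by
    rw [LinearMap.det_restrictScalars, LinearMap.det_toLin', Algebra.norm_complex_eq]
    exact Complex.normSq_eq_norm_sq _
  have h := Measure.map_linearMap_addHaar_eq_smul_addHaar (volume : Measure (Fin d → ℂ))
    (f := (Matrix.toLin' Y).restrictScalars ℝ) (by rw [hdet]; positivity)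
  rw [hdet, abs_of_nonneg (by positivity)] at h
  exact h

theorem continuous_mulVec_left {d : ℕ} (Y : Matrix (Fin d) (Fin d) ℂ) :
    Continuous (fun w : Fin d → ℂ => Y *ᵥ w) :=
  LinearMap.continuous_of_finiteDimensional Y.mulVecLin

theorem measurableEmbedding_mulVec {d : ℕ} (Y : Matrix (Fin d) (Fin d) ℂ) (hY : Y.det ≠ 0) :
    MeasurableEmbedding (fun w : Fin d → ℂ => Y *ᵥ w) :=
  (continuous_mulVec_left Y).measurableEmbedding
    (Matrix.mulVec_injective_of_isUnit ((Matrix.isUnit_iff_isUnit_det Y).2 hY.isUnit))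

theorem integral_comp_mulVec {d : ℕ} (Y : Matrix (Fin d) (Fin d) ℂ) (hY : Y.det ≠ 0)
    (f : (Fin d → ℂ) → ℝ) :
    ∫ z, f z = ‖Y.det‖ ^ 2 * ∫ w, f (Y *ᵥ w) := by
  rw [← (measurableEmbedding_mulVec Y hY).integral_map, map_mulVec_volume Y hY,
    integral_smul_measure, ENNReal.toReal_ofReal (by positivity), smul_eq_mul,
    mul_inv_cancel_left₀ (by positivity)]

theorem integrable_comp_mulVec {d : ℕ} (Y : Matrix (Fin d) (Fin d) ℂ) (hY : Y.det ≠ 0)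
    {f : (Fin d → ℂ) → ℝ} (hf : Integrable f) : Integrable (fun w => f (Y *ᵥ w)) := by
  have := (measurableEmbedding_mulVec Y hY).integrable_map_iff (g := f) (μ := volume)
  rw [map_mulVec_volume Y hY] at this
  exact this.1 (hf.smul_measure ENNReal.ofReal_ne_top)

theorem ae_dotProduct_ne_zero {d : ℕ} {u : Fin d → ℂ} (hu : u ≠ 0) :
    ∀ᵐ z : Fin d → ℂ, u ⬝ᵥ z ≠ 0 := by
  let S : Submodule ℝ (Fin d → ℂ) := LinearMap.ker ((dotProductBilin ℂ ℂ u).restrictScalars ℝ)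
  have hS : S ≠ ⊤ := by
    intro h
    obtain ⟨k, hk⟩ := Function.ne_iff.1 hu
    have : Pi.single k 1 ∈ S := h ▸ Submodule.mem_top
    simp [S, dotProductBilin] at this
    exact hk this
  have := Measure.addHaar_submodule volume S hS
  rw [ae_iff]
  convert this using 2
  ext z
  simp [S, dotProductBilin]

theorem integrable_and_integral_log_coord {d : ℕ} (k : Fin d) :
    Integrable (fun z : Fin d → ℂ => Real.log (‖z k‖ ^ 2) * gaussWeight z) ∧
    ∫ z : Fin d → ℂ, Real.log (‖z k‖ ^ 2) * gaussWeight z =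
      -(Real.pi ^ d * Real.eulerMascheroniConstant) := by
  let g : Fin d → ℂ → ℝ := fun j w =>
    if j = k then Real.log (‖w‖ ^ 2) * Real.exp (-‖w‖ ^ 2) else Real.exp (-‖w‖ ^ 2)
  have h : ∀ z : Fin d → ℂ, Real.log (‖z k‖ ^ 2) * gaussWeight z = ∏ j, g j (z j) := by
    intro z
    rw [gaussWeight_eq_prod, ← Finset.mul_prod_erase _ _ (Finset.mem_univ k),
      ← Finset.mul_prod_erase _ (fun j => g j (z j)) (Finset.mem_univ k), ← mul_assoc]
    congr 1
    · simp [g]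
    · exact Finset.prod_congr rfl fun j hj => by simp [g, (Finset.mem_erase.1 hj).1]
  simp_rw [h]
  constructor
  · refine Integrable.fintype_prod fun j => ?_
    by_cases hj : j = k
    · simpa [g, hj] using integrable_log_norm_sq_mul_exp_neg_norm_sq
    · simp only [g, hj, if_false]
      exact not_imp_comm.1 integral_undef (integral_exp_neg_norm_sq ▸ Real.pi_ne_zero)
  · rw [integral_fintype_prod_volume_eq_prod, ← Finset.mul_prod_erase _ _ (Finset.mem_univ k)]
    have h1 : ∀ j ∈ Finset.univ.erase k, ∫ w, g j w = Real.pi := fun j hj => by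
      simp only [g, (Finset.mem_erase.1 hj).1, if_false, integral_exp_neg_norm_sq]
    rw [Finset.prod_congr rfl h1]
    simp only [g, if_true, integral_log_norm_sq_mul_exp_neg_norm_sq, Finset.prod_const,
      Finset.card_erase_of_mem (Finset.mem_univ k), Finset.card_univ, Fintype.card_fin]
    have hd : d = (d - 1) + 1 := by have := k.pos; omega
    conv_rhs => rw [hd, pow_succ]
    ring

theorem exists_unitary_row {d : ℕ} (u : Fin d → ℂ) (hu : ∑ k, ‖u k‖ ^ 2 = 1) :
    ∃ (U : Matrix (Fin d) (Fin d) ℂ) (k : Fin d), U * Uᴴ = 1 ∧ U k = u := by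
  have hd : Nonempty (Fin d) := by
    by_contra h
    rw [not_nonempty_iff] at h
    simp at hu
  obtain ⟨k⟩ := hd
  let v : Fin d → EuclideanSpace ℂ (Fin d) := fun _ => WithLp.toLp 2 (star u)
  have hv : Orthonormal ℂ (({k} : Set (Fin d)).domRestrict v) := by
    rw [orthonormal_iff_ite]
    intro i j
    rw [if_pos (Subsingleton.elim i j), Set.domRestrict_apply, Set.domRestrict_apply]
    change inner ℂ (v k) (v k) = 1
    have hvk : ‖v k‖ ^ 2 = 1 := by
      rw [EuclideanSpace.norm_sq_eq]
      simpa [v] using hu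
    rw [inner_self_eq_norm_sq_to_K, ← RCLike.ofReal_pow, hvk, RCLike.ofReal_one]
  obtain ⟨b, hb⟩ := hv.exists_orthonormalBasis_extension_of_card_eq (by simp)
  refine ⟨Matrix.of fun i j => star (b i j), k, ?_, ?_⟩
  · ext i j
    have := orthonormal_iff_ite.1 b.orthonormal i j
    rw [EuclideanSpace.inner_eq_star_dotProduct] at this
    rw [Matrix.one_apply, ← this]
    simp [Matrix.mul_apply, dotProduct, mul_comm]
  · ext j
    rw [Matrix.of_apply, hb k rfl]
    simp [v]

theorem gaussWeight_mulVec {d : ℕ} {U : Matrix (Fin d) (Fin d) ℂ} (hU : U * Uᴴ = 1)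
    (z : Fin d → ℂ) : gaussWeight (U *ᵥ z) = gaussWeight z := by
  have key : ∀ x : Fin d → ℂ, ((∑ k, ‖x k‖ ^ 2 : ℝ) : ℂ) = star x ⬝ᵥ x := fun x => by
    simp [dotProduct, Complex.conj_mul']
  have : ∑ k, ‖(U *ᵥ z) k‖ ^ 2 = ∑ k, ‖z k‖ ^ 2 := by
    have : ((∑ k, ‖(U *ᵥ z) k‖ ^ 2 : ℝ) : ℂ) = ((∑ k, ‖z k‖ ^ 2 : ℝ) : ℂ) := by
      rw [key, key, star_mulVec, ← dotProduct_mulVec, mulVec_mulVec, mul_eq_one_comm.1 hU,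
        one_mulVec]
    exact_mod_cast this
  rw [gaussWeight, gaussWeight, this]

theorem integrable_and_integral_log_dotProduct {d : ℕ} {u : Fin d → ℂ} (hu : u ≠ 0) :
    Integrable (fun z : Fin d → ℂ => Real.log (‖u ⬝ᵥ z‖ ^ 2) * gaussWeight z) ∧
    ∫ z : Fin d → ℂ, Real.log (‖u ⬝ᵥ z‖ ^ 2) * gaussWeight z =
      Real.pi ^ d * (Real.log (∑ k, ‖u k‖ ^ 2) - Real.eulerMascheroniConstant) := by
  set s := ∑ k, ‖u k‖ ^ 2 with hs
  have hs0 : 0 < s := by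
    obtain ⟨k, hk⟩ := Function.ne_iff.1 hu
    exact Finset.sum_pos' (fun _ _ => by positivity)
      ⟨k, Finset.mem_univ k, pow_pos (norm_pos_iff.2 hk) 2⟩
  set r := Real.sqrt s
  have hr : r ^ 2 = s := Real.sq_sqrt hs0.le
  have hr0 : 0 < r := Real.sqrt_pos.2 hs0
  obtain ⟨U, k, hU, hUk⟩ := exists_unitary_row ((r⁻¹ : ℂ) • u) (by
    simp only [Pi.smul_apply, smul_eq_mul, norm_mul, norm_inv, Complex.norm_real, mul_pow,
      Real.norm_of_nonneg hr0.le]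
    rw [← Finset.mul_sum, ← hs, ← hr, inv_pow, inv_mul_cancel₀ (by positivity)])
  have hdet1 : ‖U.det‖ ^ 2 = 1 := by
    have := congrArg Matrix.det hU
    rw [det_mul, det_conjTranspose, Complex.star_def, Complex.mul_conj, det_one,
      Complex.normSq_eq_norm_sq] at this
    exact_mod_cast this
  have hdet : U.det ≠ 0 := fun h => by simp [h] at hdet1
  obtain ⟨hi, hI⟩ := integrable_and_integral_log_coord k
  have hw : Integrable (fun z : Fin d → ℂ => gaussWeight z) := by
    simpa using (PolyGrowth.const (d := d) (1 : ℝ)).integrable_mul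
  have hae : (fun z : Fin d → ℂ => Real.log (‖u ⬝ᵥ z‖ ^ 2) * gaussWeight z) =ᵐ[volume]
      fun z => Real.log s * gaussWeight z +
        Real.log (‖(U *ᵥ z) k‖ ^ 2) * gaussWeight (U *ᵥ z) := by
    filter_upwards [ae_dotProduct_ne_zero hu] with z hz
    have h1 : (U *ᵥ z) k = (r⁻¹ : ℝ) * (u ⬝ᵥ z) := by
      rw [mulVec, hUk, smul_dotProduct, smul_eq_mul, Complex.ofReal_inv]
    have h2 : ‖u ⬝ᵥ z‖ ^ 2 = s * ‖(U *ᵥ z) k‖ ^ 2 := by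
      rw [h1, norm_mul, mul_pow, Complex.norm_real, Real.norm_of_nonneg (inv_nonneg.2 hr0.le),
        inv_pow, hr, mul_inv_cancel_left₀ hs0.ne']
    have h3 : ‖(U *ᵥ z) k‖ ^ 2 ≠ 0 := by
      intro h
      rw [h, mul_zero] at h2
      exact hz (norm_eq_zero.1 (pow_eq_zero_iff two_ne_zero |>.1 h2))
    rw [h2, Real.log_mul hs0.ne' h3, gaussWeight_mulVec hU]
    ring
  have hi' := integrable_comp_mulVec U hdet hi
  refine ⟨((hw.const_mul _).add hi').congr hae.symm, ?_⟩
  rw [integral_congr_ae hae, integral_add (hw.const_mul _) hi', integral_const_mul,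
    integral_gaussWeight]
  have := integral_comp_mulVec U hdet (fun z => Real.log (‖z k‖ ^ 2) * gaussWeight z)
  rw [hdet1, one_mul] at this
  rw [← this, hI]
  ring

/-- The product of the squared moduli of the linear forms given by the rows of `V`. -/
noncomputable def formProd {n d : ℕ} (V : Matrix (Fin n) (Fin d) ℂ) (z : Fin d → ℂ) : ℝ :=
  ∏ i, ‖star (V i) ⬝ᵥ z‖ ^ 2

theorem formProd_nonneg {n d : ℕ} (V : Matrix (Fin n) (Fin d) ℂ) (z : Fin d → ℂ) :
    0 ≤ formProd V z :=
  Finset.prod_nonneg fun _ _ => by positivity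

theorem polyGrowth_formProd {n d : ℕ} (V : Matrix (Fin n) (Fin d) ℂ) :
    PolyGrowth (formProd V) :=
  PolyGrowth.prod _ fun _ => (PolyGrowth.dotProduct _).norm.pow 2

theorem permanent_mul_conjTranspose {n d : ℕ} (V : Matrix (Fin n) (Fin d) ℂ) :
    Real.pi ^ d * (V * Vᴴ).permanent = ((∫ z, formProd V z * gaussWeight z : ℝ) : ℂ) := by
  rw [← permanent_transpose, permanent]
  have h := integral_wick (fun i k => star (V i k)) V
  have h1 : ∀ z : Fin d → ℂ, (∏ i, ∑ k, star (V i k) * z k) *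
      (∏ i, ∑ k, V i k * (starRingEnd ℂ) (z k)) * (gaussWeight z : ℂ) =
      ((formProd V z * gaussWeight z : ℝ) : ℂ) := by
    intro z
    rw [← Finset.prod_mul_distrib, formProd, Complex.ofReal_mul, Complex.ofReal_prod]
    congr 1
    refine Finset.prod_congr rfl fun i _ => ?_
    have : ∑ k, V i k * (starRingEnd ℂ) (z k) = (starRingEnd ℂ) (star (V i) ⬝ᵥ z) := by
      simp [dotProduct]
    rw [this, ← Complex.normSq_eq_norm_sq, ← Complex.mul_conj]
    rfl
  simp_rw [h1] at h
  rw [integral_complex_ofReal] at h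
  rw [h]
  simp [Matrix.mul_apply, mul_comm]

theorem integral_pos_of_ae_ne_zero {d : ℕ} {f : (Fin d → ℂ) → ℝ} (hf : ∀ z, 0 ≤ f z)
    (hi : Integrable f) (h0 : ∀ᵐ z, f z ≠ 0) : 0 < ∫ z, f z := by
  refine (integral_nonneg hf).lt_of_ne' fun h => ?_
  have h1 := (integral_eq_zero_iff_of_nonneg hf hi).1 h
  have : ∀ᵐ _ : Fin d → ℂ, False := by
    filter_upwards [h0, h1] with z hz hz' using hz hz'
  exact this.exists.elim fun _ h => h

theorem ae_form_ne_zero {n d : ℕ} {V : Matrix (Fin n) (Fin d) ℂ} (hV : ∀ i, V i ≠ 0) :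
    ∀ᵐ z : Fin d → ℂ, ∀ i, star (V i) ⬝ᵥ z ≠ 0 :=
  ae_all_iff.2 fun i => ae_dotProduct_ne_zero (star_ne_zero.2 (hV i))

theorem sum_norm_sq_vecMul {d : ℕ} (v : Fin d → ℂ) (Y : Matrix (Fin d) (Fin d) ℂ) :
    ∑ k, ‖(star v ᵥ* Y) k‖ ^ 2 = (star v ⬝ᵥ (Y * Yᴴ) *ᵥ v).re := by
  have : star v ⬝ᵥ (Y * Yᴴ) *ᵥ v = ((∑ k, ‖(star v ᵥ* Y) k‖ ^ 2 : ℝ) : ℂ) := by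
    rw [← mulVec_mulVec, dotProduct_mulVec]
    have : Yᴴ *ᵥ v = star (star v ᵥ* Y) := by rw [star_vecMul, star_star]
    rw [this]
    simp [dotProduct, Complex.mul_conj']
  rw [this, Complex.ofReal_re]

theorem trace_mul_conjTranspose_re {d : ℕ} (Y : Matrix (Fin d) (Fin d) ℂ) :
    (Y * Yᴴ).trace.re = ∑ k, ∑ l, ‖Y k l‖ ^ 2 := by
  have : (Y * Yᴴ).trace = ((∑ k, ∑ l, ‖Y k l‖ ^ 2 : ℝ) : ℂ) := by
    simp [Matrix.trace, Matrix.mul_apply, Complex.mul_conj']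
  rw [this, Complex.ofReal_re]

theorem det_mul_conjTranspose_re {d : ℕ} (Y : Matrix (Fin d) (Fin d) ℂ) :
    (Y * Yᴴ).det.re = ‖Y.det‖ ^ 2 := by
  rw [det_mul, det_conjTranspose, Complex.star_def, Complex.mul_conj, Complex.ofReal_re,
    Complex.normSq_eq_norm_sq]

theorem exists_eq_mul_conjTranspose {d : ℕ} {X : Matrix (Fin d) (Fin d) ℂ} (hX : X.PosDef) :
    ∃ Y : Matrix (Fin d) (Fin d) ℂ, X = Y * Yᴴ ∧ Y.det ≠ 0 := by
  obtain ⟨B, hB⟩ : ∃ B : Matrix (Fin d) (Fin d) ℂ, X = Bᴴ * B := by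
    open scoped MatrixOrder in
    exact CStarAlgebra.nonneg_iff_eq_star_mul_self.mp hX.posSemidef.nonneg
  refine ⟨Bᴴ, by rw [conjTranspose_conjTranspose, hB], fun h => ?_⟩
  have := hX.det_pos
  rw [hB, det_mul, h, zero_mul] at this
  exact this.ne rfl

theorem exp_phiV_le_integral {n d : ℕ} {V : Matrix (Fin n) (Fin d) ℂ} (hV : ∀ i, V i ≠ 0)
    {X : Matrix (Fin d) (Fin d) ℂ} (hX : X.PosDef) :
    Real.pi ^ d * Real.exp (phiV V X - Real.eulerMascheroniConstant * n) ≤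
      ∫ z, formProd V z * gaussWeight z := by
  obtain ⟨Y, rfl, hY⟩ := exists_eq_mul_conjTranspose hX
  rw [integral_comp_mulVec Y hY]
  set u : Fin n → Fin d → ℂ := fun i => star (V i) ᵥ* Y with hu_def
  have hYinj : Function.Injective (fun v : Fin d → ℂ => v ᵥ* Y) :=
    vecMul_injective_of_isUnit ((Matrix.isUnit_iff_isUnit_det Y).2 hY.isUnit)
  have hu : ∀ i, u i ≠ 0 := fun i h =>
    star_ne_zero.2 (hV i) (hYinj (by simpa [u] using h))
  set m : ℝ := (∑ i, (Real.log (∑ k, ‖u i k‖ ^ 2) - Real.eulerMascheroniConstant)) -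
    ∑ k, ∑ l, ‖Y k l‖ ^ 2 + d with hm
  have hphi : phiV V (Y * Yᴴ) - Real.eulerMascheroniConstant * n =
      Real.log (‖Y.det‖ ^ 2) + m := by
    rw [phiV, trace_mul_conjTranspose_re, det_mul_conjTranspose_re, hm, Finset.sum_sub_distrib]
    simp only [u, sum_norm_sq_vecMul, Finset.sum_const, Finset.card_univ, Fintype.card_fin,
      nsmul_eq_mul]
    ring
  rw [hphi, Real.exp_add, Real.exp_log (by positivity)]
  suffices Real.exp m * Real.pi ^ d ≤
      ∫ w, formProd V (Y *ᵥ w) * gaussWeight (Y *ᵥ w) by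
    calc _ = ‖Y.det‖ ^ 2 * (Real.exp m * Real.pi ^ d) := by ring
      _ ≤ _ := by gcongr
  have hlog := fun i => integrable_and_integral_log_dotProduct (hu i)
  have hsq : ∀ v : Fin d → ℂ, Integrable fun w : Fin d → ℂ => ‖v ⬝ᵥ w‖ ^ 2 * gaussWeight w :=
    fun v => ((PolyGrowth.dotProduct v).norm.pow 2).integrable_mul
  have hw : Integrable (fun z : Fin d → ℂ => gaussWeight z) := by
    simpa using (PolyGrowth.const (d := d) (1 : ℝ)).integrable_mul
  let e : Fin d → Fin d → ℂ := fun k => Pi.single k 1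
  let G : (Fin d → ℂ) → ℝ := fun w =>
    Real.exp m * (((1 - m) * gaussWeight w +
      ∑ i, Real.log (‖u i ⬝ᵥ w‖ ^ 2) * gaussWeight w) -
      ∑ k, ‖Y k ⬝ᵥ w‖ ^ 2 * gaussWeight w + ∑ k, ‖e k ⬝ᵥ w‖ ^ 2 * gaussWeight w)
  have hi1 := integrable_finsetSum (Finset.univ : Finset (Fin n)) fun i _ => (hlog i).1
  have hi2 := integrable_finsetSum (Finset.univ : Finset (Fin d)) fun k _ => hsq (Y k)
  have hi3 := integrable_finsetSum (Finset.univ : Finset (Fin d)) fun k _ => hsq (e k)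
  have hi0 := hw.const_mul (1 - m)
  have hi01 : Integrable fun w => (1 - m) * gaussWeight w +
      ∑ i, Real.log (‖u i ⬝ᵥ w‖ ^ 2) * gaussWeight w := hi0.add hi1
  have hi012 : Integrable fun w => (1 - m) * gaussWeight w +
      ∑ i, Real.log (‖u i ⬝ᵥ w‖ ^ 2) * gaussWeight w -
      ∑ k, ‖Y k ⬝ᵥ w‖ ^ 2 * gaussWeight w := hi01.sub hi2
  have hG : Integrable G := (hi012.add hi3).const_mul _
  have hGint : ∫ w, G w = Real.exp m * Real.pi ^ d := by
    have he : ∀ k, ∑ l, ‖e k l‖ ^ 2 = 1 := fun k => by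
      simp [e, Pi.single_apply, apply_ite (fun x : ℂ => ‖x‖ ^ 2)]
    simp only [G]
    rw [integral_const_mul, integral_add hi012 hi3,
      integral_sub hi01 hi2, integral_add hi0 hi1, integral_const_mul,
      integral_gaussWeight, integral_finsetSum _ fun i _ => (hlog i).1,
      integral_finsetSum _ fun k _ => hsq (Y k), integral_finsetSum _ fun k _ => hsq (e k)]
    simp_rw [fun i => (hlog i).2, integral_norm_sq_dotProduct_mul_gaussWeight, he,
      ← Finset.mul_sum]
    rw [hm]
    simp only [Finset.sum_const, Finset.card_univ, Fintype.card_fin, nsmul_eq_mul, mul_one]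
    ring
  rw [← hGint]
  refine integral_mono_ae hG
    (integrable_comp_mulVec Y hY (polyGrowth_formProd V).integrable_mul) ?_
  filter_upwards [ae_all_iff.2 fun i => ae_dotProduct_ne_zero (hu i)] with w hw
  set h : ℝ := (∑ i, Real.log (‖u i ⬝ᵥ w‖ ^ 2)) - ∑ k, ‖Y k ⬝ᵥ w‖ ^ 2 + ∑ k, ‖w k‖ ^ 2 with hh
  have h1 : formProd V (Y *ᵥ w) * gaussWeight (Y *ᵥ w) = Real.exp h * gaussWeight w := by
    have hprod : formProd V (Y *ᵥ w) = Real.exp (∑ i, Real.log (‖u i ⬝ᵥ w‖ ^ 2)) := by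
      rw [Real.exp_sum, formProd]
      refine Finset.prod_congr rfl fun i _ => ?_
      rw [Real.exp_log (pow_pos (norm_pos_iff.2 (hw i)) 2), dotProduct_mulVec]
    rw [hprod, gaussWeight, gaussWeight, ← Real.exp_add, ← Real.exp_add, hh]
    congr 1
    simp only [mulVec]
    ring
  have h2 : G w = Real.exp m * (1 + (h - m)) * gaussWeight w := by
    simp only [G, e, ← Finset.sum_mul, single_one_dotProduct]
    rw [hh]
    ring
  rw [h1, h2]
  refine mul_le_mul_of_nonneg_right ?_ (gaussWeight_pos w).le
  calc Real.exp m * (1 + (h - m)) ≤ Real.exp m * Real.exp (h - m) := by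
        gcongr
        linarith [Real.add_one_le_exp (h - m)]
    _ = Real.exp h := by rw [← Real.exp_add]; ring_nf

/-- The matrix of second moments of the measure on `ℂ^d` whose density is `F` times the
Gaussian weight. -/
noncomputable def secondMoment {d : ℕ} (F : (Fin d → ℂ) → ℝ) : Matrix (Fin d) (Fin d) ℂ :=
  Matrix.of fun k l => ∫ z : Fin d → ℂ,
    (z k * (starRingEnd ℂ) (z l)) * ((F z * gaussWeight z : ℝ) : ℂ)

theorem dotProduct_secondMoment_mulVec {d : ℕ} {F : (Fin d → ℂ) → ℝ} (hF : PolyGrowth F)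
    (u : Fin d → ℂ) :
    u ⬝ᵥ secondMoment F *ᵥ star u =
      ((∫ z, ‖u ⬝ᵥ z‖ ^ 2 * (F z * gaussWeight z) : ℝ) : ℂ) := by
  have hFc : PolyGrowth fun z => (F z : ℂ) :=
    ⟨Complex.continuous_ofReal.comp hF.1, by simpa using hF.2⟩
  have hint : ∀ k l, Integrable fun z : Fin d → ℂ => (u k * star (u l)) *
      ((z k * (starRingEnd ℂ) (z l)) * ((F z * gaussWeight z : ℝ) : ℂ)) := fun k l => by
    have := ((((PolyGrowth.coord k).mul (PolyGrowth.coord l).conj).mul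
      hFc).integrable_mul_ofReal).const_mul (u k * star (u l))
    refine this.congr (.of_forall fun z => ?_)
    push_cast
    ring
  have h : ∀ z : Fin d → ℂ, ((‖u ⬝ᵥ z‖ ^ 2 * (F z * gaussWeight z) : ℝ) : ℂ) =
      ∑ k, ∑ l, (u k * star (u l)) *
        ((z k * (starRingEnd ℂ) (z l)) * ((F z * gaussWeight z : ℝ) : ℂ)) := by
    intro z
    rw [Complex.ofReal_mul, ← Complex.normSq_eq_norm_sq, ← Complex.mul_conj]
    simp only [dotProduct, map_sum, map_mul, Finset.sum_mul_sum]
    simp only [Finset.sum_mul]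
    refine Finset.sum_congr rfl fun k _ => Finset.sum_congr rfl fun l _ => ?_
    rw [Complex.star_def]
    ring
  rw [← integral_complex_ofReal]
  simp_rw [h]
  rw [integral_finsetSum _ fun k _ => integrable_finsetSum _ fun l _ => hint k l]
  simp_rw [integral_finsetSum _ fun l _ => hint _ l, integral_const_mul]
  simp only [dotProduct, mulVec, secondMoment, Finset.mul_sum, Matrix.of_apply, Pi.star_apply]
  refine Finset.sum_congr rfl fun k _ => Finset.sum_congr rfl fun l _ => ?_
  ring

theorem isHermitian_secondMoment {d : ℕ} (F : (Fin d → ℂ) → ℝ) :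
    (secondMoment F).IsHermitian := by
  ext k l
  simp only [conjTranspose_apply, secondMoment, Matrix.of_apply, Complex.star_def]
  rw [← integral_conj]
  refine integral_congr_ae (.of_forall fun z => ?_)
  simp [mul_comm]

theorem posDef_secondMoment {d : ℕ} {F : (Fin d → ℂ) → ℝ} (hF : PolyGrowth F)
    (hF0 : ∀ z, 0 ≤ F z) (hFae : ∀ᵐ z, F z ≠ 0) : (secondMoment F).PosDef := by
  refine .of_dotProduct_mulVec_pos (isHermitian_secondMoment F) fun x hx => ?_
  have h := dotProduct_secondMoment_mulVec hF (star x)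
  rw [star_star] at h
  rw [h, Complex.zero_lt_real]
  refine integral_pos_of_ae_ne_zero
    (fun z => mul_nonneg (by positivity) (mul_nonneg (hF0 z) (gaussWeight_pos z).le)) ?_ ?_
  · simpa only [mul_assoc] using
      (((PolyGrowth.dotProduct (star x)).norm.pow 2).mul hF).integrable_mul
  · filter_upwards [hFae, ae_dotProduct_ne_zero (star_ne_zero.2 hx)] with z hz hz'
    have := (gaussWeight_pos z).ne'
    have := norm_ne_zero_iff.2 hz'
    positivity

theorem sum_integral_eq_trace {d : ℕ} {F : (Fin d → ℂ) → ℝ} (hF : PolyGrowth F)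
    (K : Matrix (Fin d) (Fin d) ℂ) :
    ∑ k, ∫ z, ‖K k ⬝ᵥ z‖ ^ 2 * (F z * gaussWeight z) = (K * secondMoment F * Kᴴ).trace.re := by
  have : (K * secondMoment F * Kᴴ).trace =
      ((∑ k, ∫ z, ‖K k ⬝ᵥ z‖ ^ 2 * (F z * gaussWeight z) : ℝ) : ℂ) := by
    rw [Matrix.trace, Complex.ofReal_sum]
    refine Finset.sum_congr rfl fun k _ => ?_
    rw [← dotProduct_secondMoment_mulVec hF, dotProduct_mulVec]
    rfl
  rw [this, Complex.ofReal_re]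

theorem exists_integral_le_exp_phiV {n d : ℕ} {V : Matrix (Fin n) (Fin d) ℂ}
    (hV : ∀ i, V i ≠ 0) :
    ∃ X : Matrix (Fin d) (Fin d) ℂ, X.PosDef ∧
      ∫ z, formProd V z * gaussWeight z ≤ Real.pi ^ d * Real.exp (phiV V X) := by
  set F := formProd V with hF_def
  have hF : PolyGrowth F := polyGrowth_formProd V
  have hF0 : ∀ z, 0 ≤ F z := formProd_nonneg V
  have hFae : ∀ᵐ z, F z ≠ 0 := by
    filter_upwards [ae_form_ne_zero hV] with z hz
    exact Finset.prod_ne_zero_iff.2 fun i _ => pow_ne_zero 2 (norm_ne_zero_iff.2 (hz i))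
  set N := ∫ z, F z * gaussWeight z with hN
  have hN0 : 0 < N := by
    refine integral_pos_of_ae_ne_zero (fun z => mul_nonneg (hF0 z) (gaussWeight_pos z).le)
      hF.integrable_mul ?_
    filter_upwards [hFae] with z hz using mul_ne_zero hz (gaussWeight_pos z).ne'
  set X : Matrix (Fin d) (Fin d) ℂ := ((N⁻¹ : ℝ) : ℂ) • secondMoment F with hX_def
  have hX : X.PosDef := (posDef_secondMoment hF hF0 hFae).smul
    (Complex.zero_lt_real.2 (inv_pos.2 hN0))
  refine ⟨X, hX, ?_⟩
  have hform : ∀ u : Fin d → ℂ, ∫ z, ‖u ⬝ᵥ z‖ ^ 2 * (F z * gaussWeight z) =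
      N * (u ⬝ᵥ X *ᵥ star u).re := fun u => by
    rw [hX_def, smul_mulVec, dotProduct_smul, dotProduct_secondMoment_mulVec hF, smul_eq_mul,
      Complex.re_ofReal_mul, Complex.ofReal_re, mul_inv_cancel_left₀ hN0.ne']
  have htrace : ∀ K : Matrix (Fin d) (Fin d) ℂ,
      ∑ k, ∫ z, ‖K k ⬝ᵥ z‖ ^ 2 * (F z * gaussWeight z) = N * (K * X * Kᴴ).trace.re := fun K => by
    rw [sum_integral_eq_trace hF, hX_def, mul_smul_comm, smul_mul_assoc, trace_smul, smul_eq_mul,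
      Complex.re_ofReal_mul, mul_inv_cancel_left₀ hN0.ne']
  obtain ⟨Y, hXY, hY⟩ := exists_eq_mul_conjTranspose hX
  have hYu : IsUnit Y.det := hY.isUnit
  set K := Y⁻¹ with hK
  have hKX : (K * X * Kᴴ).trace.re = d := by
    have : K * X * Kᴴ = 1 := by
      rw [hXY, ← Matrix.mul_assoc, hK, nonsing_inv_mul _ hYu, Matrix.one_mul,
        ← conjTranspose_mul, nonsing_inv_mul _ hYu, conjTranspose_one]
    simp [this]
  have h1X : ((1 : Matrix (Fin d) (Fin d) ℂ) * X * 1ᴴ).trace.re = X.trace.re := by simp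
  set s : Fin n → ℝ := fun i => (star (V i) ⬝ᵥ X *ᵥ V i).re with hs
  have hs0 : ∀ i, 0 < s i := fun i => (Complex.pos_iff.1 (hX.dotProduct_mulVec_pos (hV i))).1
  set D := ‖Y.det‖ ^ 2 with hD
  have hD0 : 0 < D := by positivity
  have hdet : X.det.re = D := by rw [hXY, det_mul_conjTranspose_re]
  set c := N / (Real.pi ^ d * D) with hc
  have hpi : 0 < Real.pi ^ d := by positivity
  have hc0 : 0 < c := by positivity
  suffices h : Real.log c ≤ (∑ i, Real.log (s i)) - X.trace.re + d by
    have hphi : phiV V X = (∑ i, Real.log (s i)) - X.trace.re + d + Real.log D := by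
      rw [phiV, hdet]
      ring
    rw [hphi, Real.exp_add, Real.exp_log hD0]
    have : N = Real.pi ^ d * (c * D) := by rw [hc]; field_simp
    rw [this]
    gcongr
    rwa [← Real.log_le_iff_le_exp hc0]
  have hgK : ∫ z : Fin d → ℂ, gaussWeight (K *ᵥ z) = Real.pi ^ d * D := by
    rw [integral_comp_mulVec Y hY]
    simp only [mulVec_mulVec, hK, nonsing_inv_mul _ hYu, one_mulVec, integral_gaussWeight]
    ring
  have hKdet : K.det ≠ 0 := by
    rw [hK, det_nonsing_inv]
    exact (Ring.inverse_unit hYu.unit ▸ (hYu.unit⁻¹).isUnit).ne_zero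
  have hw : Integrable (fun z : Fin d → ℂ => gaussWeight z) := by
    simpa using (PolyGrowth.const (d := d) (1 : ℝ)).integrable_mul
  have hwK := integrable_comp_mulVec K hKdet hw
  have hsq : ∀ v : Fin d → ℂ, Integrable fun z : Fin d → ℂ =>
      ‖v ⬝ᵥ z‖ ^ 2 * (F z * gaussWeight z) := fun v => by
    simpa only [mul_assoc] using (((PolyGrowth.dotProduct v).norm.pow 2).mul hF).integrable_mul
  have hFw : Integrable fun z => F z * gaussWeight z := hF.integrable_mul
  let I : Matrix (Fin d) (Fin d) ℂ := 1
  have hi0 := hFw.const_mul ((∑ i, (Real.log (s i) - 1)) - Real.log c - 1)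
  have hi1 := integrable_finsetSum (Finset.univ : Finset (Fin n)) fun i _ =>
    (hsq (star (V i))).const_mul (s i)⁻¹
  have hi2 := integrable_finsetSum (Finset.univ : Finset (Fin d)) fun k _ => hsq (I k)
  have hi3 := integrable_finsetSum (Finset.univ : Finset (Fin d)) fun k _ => hsq (K k)
  have hi4 := hwK.const_mul c
  have hi01 : Integrable fun z =>
      ((∑ i, (Real.log (s i) - 1)) - Real.log c - 1) * (F z * gaussWeight z) +
      ∑ i, (s i)⁻¹ * (‖star (V i) ⬝ᵥ z‖ ^ 2 * (F z * gaussWeight z)) := hi0.add hi1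
  have hi012 : Integrable fun z =>
      ((∑ i, (Real.log (s i) - 1)) - Real.log c - 1) * (F z * gaussWeight z) +
      ∑ i, (s i)⁻¹ * (‖star (V i) ⬝ᵥ z‖ ^ 2 * (F z * gaussWeight z)) -
      ∑ k, ‖I k ⬝ᵥ z‖ ^ 2 * (F z * gaussWeight z) := hi01.sub hi2
  have hi0123 : Integrable fun z =>
      ((∑ i, (Real.log (s i) - 1)) - Real.log c - 1) * (F z * gaussWeight z) +
      ∑ i, (s i)⁻¹ * (‖star (V i) ⬝ᵥ z‖ ^ 2 * (F z * gaussWeight z)) -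
      ∑ k, ‖I k ⬝ᵥ z‖ ^ 2 * (F z * gaussWeight z) +
      ∑ k, ‖K k ⬝ᵥ z‖ ^ 2 * (F z * gaussWeight z) := hi012.add hi3
  have hnonneg : 0 ≤ ∫ z,
      (((∑ i, (Real.log (s i) - 1)) - Real.log c - 1) * (F z * gaussWeight z) +
      ∑ i, (s i)⁻¹ * (‖star (V i) ⬝ᵥ z‖ ^ 2 * (F z * gaussWeight z)) -
      ∑ k, ‖I k ⬝ᵥ z‖ ^ 2 * (F z * gaussWeight z) +
      ∑ k, ‖K k ⬝ᵥ z‖ ^ 2 * (F z * gaussWeight z) + c * gaussWeight (K *ᵥ z)) := by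
    refine integral_nonneg_of_ae ?_
    filter_upwards [ae_form_ne_zero hV] with z hz
    have hq : ∀ i, 0 < ‖star (V i) ⬝ᵥ z‖ ^ 2 := fun i => pow_pos (norm_pos_iff.2 (hz i)) 2
    set p := F z * gaussWeight z with hp
    have hFpos : 0 < F z := Finset.prod_pos fun i _ => hq i
    have hp0 : 0 < p := mul_pos hFpos (gaussWeight_pos z)
    have hlogp : Real.log p = (∑ i, Real.log (‖star (V i) ⬝ᵥ z‖ ^ 2)) - ∑ k, ‖I k ⬝ᵥ z‖ ^ 2 := by
      have hI : ∀ k, I k ⬝ᵥ z = z k := fun k => by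
        change ((1 : Matrix (Fin d) (Fin d) ℂ) *ᵥ z) k = z k
        rw [one_mulVec]
      rw [hp, Real.log_mul hFpos.ne' (gaussWeight_pos z).ne', hF_def, formProd,
        Real.log_prod fun i _ => (hq i).ne', gaussWeight, Real.log_exp, sub_eq_add_neg]
      simp only [hI]
    have hlogg : Real.log (gaussWeight (K *ᵥ z)) = -∑ k, ‖K k ⬝ᵥ z‖ ^ 2 := by
      rw [gaussWeight, Real.log_exp]
      rfl
    have hbound : ∑ i, Real.log (‖star (V i) ⬝ᵥ z‖ ^ 2) ≤
        ∑ i, (Real.log (s i) - 1) + ∑ i, (s i)⁻¹ * ‖star (V i) ⬝ᵥ z‖ ^ 2 := by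
      rw [← Finset.sum_add_distrib]
      refine Finset.sum_le_sum fun i _ => ?_
      have := Real.log_le_sub_one_of_pos (mul_pos (inv_pos.2 (hs0 i)) (hq i))
      rw [Real.log_mul (inv_pos.2 (hs0 i)).ne' (hq i).ne', Real.log_inv] at this
      linarith
    have hg0 : 0 < gaussWeight (K *ᵥ z) := gaussWeight_pos _
    have hlog := Real.log_le_sub_one_of_pos (div_pos (mul_pos hc0 hg0) hp0)
    rw [Real.log_div (mul_pos hc0 hg0).ne' hp0.ne', Real.log_mul hc0.ne' hg0.ne', hlogg,
      hlogp] at hlog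
    have hfin : 0 ≤ ((∑ i, (Real.log (s i) - 1)) - Real.log c - 1) +
        ∑ i, (s i)⁻¹ * ‖star (V i) ⬝ᵥ z‖ ^ 2 - ∑ k, ‖I k ⬝ᵥ z‖ ^ 2 + ∑ k, ‖K k ⬝ᵥ z‖ ^ 2 +
        c * gaussWeight (K *ᵥ z) / p := by
      linarith
    have := mul_nonneg hfin hp0.le
    rw [add_mul, div_mul_cancel₀ _ hp0.ne'] at this
    simp only [Pi.zero_apply, ← mul_assoc, ← Finset.sum_mul]
    linarith
  rw [integral_add hi0123 hi4, integral_add hi012 hi3, integral_sub hi01 hi2,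
    integral_add hi0 hi1, integral_const_mul, integral_const_mul, hgK,
    integral_finsetSum _ fun i _ => (hsq (star (V i))).const_mul (s i)⁻¹,
    integral_finsetSum _ fun k _ => hsq (I k), integral_finsetSum _ fun k _ => hsq (K k),
    htrace K, htrace I, hKX, h1X, ← hN] at hnonneg
  have hsum : ∑ i, ∫ z, (s i)⁻¹ * (‖star (V i) ⬝ᵥ z‖ ^ 2 * (F z * gaussWeight z)) = N * n := by
    have : ∀ i, ∫ z, (s i)⁻¹ * (‖star (V i) ⬝ᵥ z‖ ^ 2 * (F z * gaussWeight z)) = N := fun i => by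
      rw [integral_const_mul, hform, star_star]
      have := (hs0 i).ne'
      change (s i)⁻¹ * (N * s i) = N
      field_simp
    simp_rw [this]; simp [mul_comm]
  have hcN : c * (Real.pi ^ d * D) = N := by rw [hc]; field_simp
  rw [hsum, hcN, Finset.sum_sub_distrib] at hnonneg
  simp only [Finset.sum_const, Finset.card_univ, Fintype.card_fin, nsmul_eq_mul, mul_one]
    at hnonneg
  have h := nonneg_of_mul_nonneg_right (b := (∑ i, Real.log (s i)) - X.trace.re + d - Real.log c)
    (a := N) (by linarith) hN0
  linarith

theorem stmt0 {n d : ℕ} (A : Matrix (Fin n) (Fin n) ℂ) (V : Matrix (Fin n) (Fin d) ℂ)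
    (hA : A.PosSemidef) (hrank : A.rank = d) (hdiag : ∀ i, A i i ≠ 0)
    (hfact : A = V * Vᴴ) (hV : V.rank = d) :
    (Real.exp (-(Real.eulerMascheroniConstant * n)) * Real.exp (PhiV V) : ℂ) ≤ A.permanent ∧
      A.permanent ≤ (Real.exp (PhiV V) : ℂ) := by
  have hV0 : ∀ i, V i ≠ 0 := fun i h => hdiag i (by
    rw [hfact, Matrix.mul_apply]
    simp [h])
  set N := ∫ z, formProd V z * gaussWeight z with hN
  have hpi : 0 < Real.pi ^ d := by positivity
  have hper : A.permanent = ((N / Real.pi ^ d : ℝ) : ℂ) := by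
    have h := permanent_mul_conjTranspose V
    rw [← hfact, ← hN] at h
    have : (Real.pi : ℂ) ^ d ≠ 0 := by exact_mod_cast hpi.ne'
    rw [Complex.ofReal_div, Complex.ofReal_pow, ← h, mul_div_cancel_left₀ _ this]
  obtain ⟨X₀, hX₀, hle⟩ := exists_integral_le_exp_phiV hV0
  rw [← hN] at hle
  have hlow : ∀ X : Matrix (Fin d) (Fin d) ℂ, X.PosDef →
      Real.exp (phiV V X - Real.eulerMascheroniConstant * n) ≤ N / Real.pi ^ d := fun X hX => by
    rw [le_div_iff₀' hpi]
    exact exp_phiV_le_integral hV0 hX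
  have hP : 0 < N / Real.pi ^ d := (Real.exp_pos _).trans_le (hlow X₀ hX₀)
  have hub : ∀ r ∈ {r : ℝ | ∃ X : Matrix (Fin d) (Fin d) ℂ, X.PosDef ∧ r = phiV V X},
      r ≤ Real.log (N / Real.pi ^ d) + Real.eulerMascheroniConstant * n := by
    rintro r ⟨X, hX, rfl⟩
    have := (Real.le_log_iff_exp_le hP).2 (hlow X hX)
    linarith
  have hsup_le : PhiV V ≤ Real.log (N / Real.pi ^ d) + Real.eulerMascheroniConstant * n :=
    csSup_le ⟨_, X₀, hX₀, rfl⟩ hub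
  have hle_sup : phiV V X₀ ≤ PhiV V := le_csSup ⟨_, hub⟩ ⟨X₀, hX₀, rfl⟩
  rw [hper, ← Complex.ofReal_mul, Complex.real_le_real, Complex.real_le_real, ← Real.exp_add]
  refine ⟨?_, ?_⟩
  · rw [← Real.le_log_iff_exp_le hP]
    linarith
  · rw [div_le_iff₀' hpi]
    exact hle.trans (by gcongr)
end

section
/- Let A = V V† be an n×n Hermitian positive semidefinite matrix, where V ∈ ℂ^{n×d} has full column rank and rows v₁,…,vₙ, all nonzero. Then per(A) ≤ exp(Φ(V)), where Φ(V) = sup over Hermitian positive definite d×d matrices X of ∑_{i=1}^n log(vᵢ† X vᵢ) + log det X − tr X + d. -/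
open MeasureTheory Matrix
open scoped ComplexOrder

/-- `∑ⱼ |zⱼ|²`, the squared Euclidean length. -/
noncomputable def sqLen {ι : Type*} [Fintype ι] (z : ι → ℂ) : ℝ := ∑ j, ‖z j‖ ^ 2

theorem integral_pow_mul_conj_pow_mul_exp (k l : ℕ) :
    ∫ z : ℂ, z ^ k * star z ^ l * (Real.exp (-‖z‖ ^ 2) : ℂ) =
      if k = l then (k.factorial : ℂ) * Real.pi else 0 := by
  split_ifs with h
  · subst h
    have h1 : ∀ z : ℂ, z ^ k * star z ^ k * (Real.exp (-‖z‖ ^ 2) : ℂ) =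
        ((‖z‖ ^ ((2 * k : ℕ) : ℝ) * Real.exp (-‖z‖ ^ (2 : ℝ)) : ℝ) : ℂ) := by
      intro z
      rw [← mul_pow, Complex.star_def, Complex.mul_conj, Complex.normSq_eq_norm_sq,
        Real.rpow_natCast, Real.rpow_ofNat]
      push_cast
      rw [pow_mul]
    simp_rw [h1]
    rw [integral_complex_ofReal, Complex.integral_rpow_mul_exp_neg_rpow (by norm_num)
      (by push_cast; linarith [(Nat.cast_nonneg k : (0 : ℝ) ≤ k)])]
    have : (((2 * k : ℕ) : ℝ) + 2) / 2 = k + 1 := by push_cast; ring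
    rw [this, Real.Gamma_nat_eq_factorial]
    push_cast
    ring
  · set F : ℂ → ℂ := fun z => z ^ k * star z ^ l * (Real.exp (-‖z‖ ^ 2) : ℂ) with hF
    obtain ⟨c, hc1, hc⟩ : ∃ c : ℂ, ‖c‖ = 1 ∧ c ^ k * star c ^ l ≠ 1 := by
      have hexp : ∀ t : ℝ, Complex.exp (t * Complex.I) ^ k * star (Complex.exp (t * Complex.I)) ^ l
          = Complex.exp (((k : ℂ) - l) * t * Complex.I) := by
        intro t
        rw [Complex.star_def, ← Complex.exp_conj, ← Complex.exp_nat_mul, ← Complex.exp_nat_mul,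
          ← Complex.exp_add]
        congr 1
        simp
        ring
      have hkl : (k : ℂ) - l ≠ 0 := sub_ne_zero.mpr (by exact_mod_cast h)
      refine ⟨Complex.exp ((Real.pi / ((k : ℝ) - l) : ℝ) * Complex.I),
        Complex.norm_exp_ofReal_mul_I _, ?_⟩
      rw [hexp]
      push_cast
      rw [mul_div_cancel₀ _ hkl, Complex.exp_pi_mul_I]
      norm_num
    have h2 : ∫ z, F (c * z) = ∫ z, F z := by
      have := (LinearIsometryEquiv.measurePreserving
        (rotation ⟨c, by simp [Submonoid.unitSphere, hc1]⟩)).integral_comp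
        (rotation ⟨c, by simp [Submonoid.unitSphere, hc1]⟩).toHomeomorph.measurableEmbedding F
      exact this
    have h3 : ∀ z, F (c * z) = (c ^ k * star c ^ l) * F z := by
      intro z
      simp only [hF, norm_mul, hc1, one_mul, star_mul', mul_pow]
      ring
    simp_rw [h3] at h2
    rw [integral_const_mul] at h2
    have h4 : (c ^ k * star c ^ l - 1) * ∫ z, F z = 0 := by rw [sub_mul, h2]; ring
    exact (mul_eq_zero.mp h4).resolve_left (sub_ne_zero.mpr hc)

/-- The permutations turning `a` into `b` are counted by the fibre sizes. -/
theorem card_perm_comp_eq {κ ι : Type*} [Fintype κ] [DecidableEq κ] [Fintype ι] [DecidableEq ι]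
    (a b : κ → ι) :
    Fintype.card {σ : Equiv.Perm κ // b ∘ σ = a} =
      ∏ j, if Fintype.card {i // a i = j} = Fintype.card {i // b i = j} then
        (Fintype.card {i // a i = j}).factorial else 0 := by
  by_cases h : ∀ j, Fintype.card {i // a i = j} = Fintype.card {i // b i = j}
  · let τ : Equiv.Perm κ := Equiv.ofFiberEquiv fun j => Fintype.equivOfCardEq (h j)
    have hτ : b ∘ τ = a := funext fun i => Equiv.ofFiberEquiv_map _ i
    simp only [h, if_true]
    rw [← DomMulAct.stabilizer_card]
    refine Fintype.card_congr ((Equiv.mulRight τ⁻¹).subtypeEquiv fun σ => ?_)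
    rw [← hτ]
    constructor
    · intro h
      funext i
      have := congrFun h (τ⁻¹ i)
      simpa using this
    · intro h
      funext i
      have := congrFun h (τ i)
      simpa using this
  · push Not at h
    obtain ⟨j, hj⟩ := h
    rw [Finset.prod_eq_zero (Finset.mem_univ j) (if_neg hj), Fintype.card_eq_zero_iff]
    refine ⟨fun ⟨σ, hσ⟩ => hj ?_⟩
    subst hσ
    exact Fintype.card_congr (σ.subtypeEquiv fun i => Iff.rfl)

theorem prod_comp_eq_prod_pow_card {κ ι M : Type*} [Fintype κ] [Fintype ι] [DecidableEq ι]
    [CommMonoid M] (a : κ → ι) (z : ι → M) :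
    ∏ i, z (a i) = ∏ j, z j ^ Fintype.card {i // a i = j} := by
  classical
  rw [← Finset.prod_fiberwise' Finset.univ a z]
  simp [Fintype.card_subtype]

theorem exp_neg_sqLen {ι : Type*} [Fintype ι] (z : ι → ℂ) :
    Real.exp (-sqLen z) = ∏ j, Real.exp (-‖z j‖ ^ 2) := by
  rw [← Real.exp_sum, sqLen, Finset.sum_neg_distrib]

/-- Wick's formula for monomials in complex Gaussian variables. -/
theorem integral_monomial_mul_exp_neg_sqLen {κ ι : Type*} [Fintype κ] [DecidableEq κ] [Fintype ι]
    [DecidableEq ι] (a b : κ → ι) :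
    ∫ z : ι → ℂ, (∏ i, z (a i)) * (∏ i, star (z (b i))) * (Real.exp (-sqLen z) : ℂ) =
      Fintype.card {σ : Equiv.Perm κ // b ∘ σ = a} * (Real.pi : ℂ) ^ Fintype.card ι := by
  have h : ∀ z : ι → ℂ, (∏ i, z (a i)) * (∏ i, star (z (b i))) * (Real.exp (-sqLen z) : ℂ) =
      ∏ j, z j ^ Fintype.card {i // a i = j} * star (z j) ^ Fintype.card {i // b i = j} *
        (Real.exp (-‖z j‖ ^ 2) : ℂ) := by
    intro z
    rw [prod_comp_eq_prod_pow_card a z, prod_comp_eq_prod_pow_card b fun j => star (z j),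
      exp_neg_sqLen]
    push_cast
    rw [Finset.prod_mul_distrib, Finset.prod_mul_distrib]
  simp_rw [h]
  rw [integral_fintype_prod_volume_eq_prod fun j w => w ^ Fintype.card {i // a i = j} *
    star w ^ Fintype.card {i // b i = j} * (Real.exp (-‖w‖ ^ 2) : ℂ)]
  simp_rw [integral_pow_mul_conj_pow_mul_exp]
  rw [card_perm_comp_eq]
  push_cast
  rw [← Finset.card_univ, ← Finset.prod_const, ← Finset.prod_mul_distrib]
  refine Finset.prod_congr rfl fun j _ => ?_
  split_ifs <;> simp

/-- Continuous functions growing slower than every `exp (ε ∑ⱼ |zⱼ|²)`. -/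
def SubExpSq {ι : Type*} [Fintype ι] (g : (ι → ℂ) → ℂ) : Prop :=
  Continuous g ∧ ∀ ε : ℝ, 0 < ε → ∃ C : ℝ, ∀ z, ‖g z‖ ≤ C * Real.exp (ε * sqLen z)

namespace SubExpSq

variable {ι : Type*} [Fintype ι] {g h : (ι → ℂ) → ℂ}

theorem const (c : ℂ) : SubExpSq fun _ : ι → ℂ => c := by
  refine ⟨continuous_const, fun ε hε => ⟨‖c‖, fun z => ?_⟩⟩
  have : 0 ≤ sqLen z := Finset.sum_nonneg fun j _ => sq_nonneg _
  exact le_mul_of_one_le_right (norm_nonneg _) (Real.one_le_exp (by positivity))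

theorem add (hg : SubExpSq g) (hh : SubExpSq h) : SubExpSq fun z => g z + h z := by
  refine ⟨hg.1.add hh.1, fun ε hε => ?_⟩
  obtain ⟨C, hC⟩ := hg.2 ε hε
  obtain ⟨D, hD⟩ := hh.2 ε hε
  refine ⟨C + D, fun z => (norm_add_le _ _).trans ?_⟩
  rw [add_mul]
  exact add_le_add (hC z) (hD z)

theorem mul (hg : SubExpSq g) (hh : SubExpSq h) : SubExpSq fun z => g z * h z := by
  refine ⟨hg.1.mul hh.1, fun ε hε => ?_⟩
  obtain ⟨C, hC⟩ := hg.2 (ε / 2) (by positivity)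
  obtain ⟨D, hD⟩ := hh.2 (ε / 2) (by positivity)
  refine ⟨C * D, fun z => ?_⟩
  have : C * D * Real.exp (ε * sqLen z) =
      (C * Real.exp (ε / 2 * sqLen z)) * (D * Real.exp (ε / 2 * sqLen z)) := by
    rw [mul_mul_mul_comm, ← Real.exp_add]
    congr 2
    ring
  rw [this, norm_mul]
  exact mul_le_mul (hC z) (hD z) (norm_nonneg _) ((norm_nonneg _).trans (hC z))

theorem star (hg : SubExpSq g) : SubExpSq fun z => star (g z) :=
  ⟨hg.1.star, fun ε hε => by simpa using hg.2 ε hε⟩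

theorem coord (j : ι) : SubExpSq fun z : ι → ℂ => z j := by
  refine ⟨continuous_apply j, fun ε hε => ⟨1 + 1 / ε, fun z => ?_⟩⟩
  have h1 : ‖z j‖ ^ 2 ≤ sqLen z :=
    Finset.single_le_sum (f := fun j => ‖z j‖ ^ 2) (fun j _ => sq_nonneg _) (Finset.mem_univ j)
  have h2 := Real.add_one_le_exp (ε * sqLen z)
  have h3 : 0 ≤ sqLen z := (sq_nonneg _).trans h1
  have h4 : (1 + 1 / ε) * (ε * sqLen z + 1) = 1 + sqLen z + (ε * sqLen z + 1 / ε) := by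
    field_simp
    ring
  have h5 : 0 ≤ ε * sqLen z + 1 / ε := by positivity
  have h6 : (1 + 1 / ε) * (ε * sqLen z + 1) ≤ (1 + 1 / ε) * Real.exp (ε * sqLen z) := by gcongr
  nlinarith [sq_nonneg (‖z j‖ - 1)]

theorem sum {κ : Type*} (s : Finset κ) {g : κ → (ι → ℂ) → ℂ} (hg : ∀ i, SubExpSq (g i)) :
    SubExpSq fun z => ∑ i ∈ s, g i z := by
  classical
  induction s using Finset.induction_on with
  | empty => simpa using const 0
  | insert i s hi ih => simpa [Finset.sum_insert hi] using (hg i).add ih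

theorem prod {κ : Type*} (s : Finset κ) {g : κ → (ι → ℂ) → ℂ} (hg : ∀ i, SubExpSq (g i)) :
    SubExpSq fun z => ∏ i ∈ s, g i z := by
  classical
  induction s using Finset.induction_on with
  | empty => simpa using const 1
  | insert i s hi ih => simpa [Finset.prod_insert hi] using (hg i).mul ih

theorem dotProduct (c : ι → ℂ) : SubExpSq fun z : ι → ℂ => c ⬝ᵥ z :=
  sum _ fun j => (const (c j)).mul (coord j)

theorem quadratic (M : Matrix ι ι ℂ) : SubExpSq fun z : ι → ℂ => Star.star z ⬝ᵥ M *ᵥ z :=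
  sum _ fun j => (coord j).star.mul (dotProduct (M j))

end SubExpSq

section GaussianIntegrals

variable {ι κ : Type*} [Fintype ι] [Fintype κ]

theorem continuous_sqLen : Continuous (sqLen : (ι → ℂ) → ℝ) := by
  unfold sqLen
  fun_prop

theorem integrable_exp_neg_mul_sqLen {b : ℝ} (hb : 0 < b) :
    Integrable fun z : ι → ℂ => Real.exp (-(b * sqLen z)) := by
  have h : ∀ z : ι → ℂ, Real.exp (-(b * sqLen z)) = ∏ j, Real.exp (-b * ‖z j‖ ^ 2) := by
    intro z
    rw [← Real.exp_sum, sqLen, ← Finset.mul_sum, neg_mul]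
  simp_rw [h]
  refine Integrable.fintype_prod (f := fun _ w => Real.exp (-b * ‖w‖ ^ 2)) fun _ => ?_
  have := (GaussianFourier.integrable_cexp_neg_mul_sq_norm_add (V := ℂ) (b := (b : ℂ))
    (by simpa using hb) 0 0).re
  refine this.congr (Filter.Eventually.of_forall fun w => ?_)
  simp [← Complex.ofReal_exp, ← Complex.ofReal_pow, ← Complex.ofReal_mul, ← Complex.ofReal_neg]

theorem SubExpSq.integrable {g : (ι → ℂ) → ℂ} (hg : SubExpSq g) :
    Integrable fun z => g z * (Real.exp (-sqLen z) : ℂ) := by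
  obtain ⟨C, hC⟩ := hg.2 (1 / 2) (by norm_num)
  refine ((integrable_exp_neg_mul_sqLen (ι := ι) (b := 1 / 2) (by norm_num)).const_mul C).mono'
    (hg.1.mul (by have := continuous_sqLen (ι := ι); fun_prop)).aestronglyMeasurable
    (Filter.Eventually.of_forall fun z => ?_)
  rw [norm_mul, Complex.norm_real, Real.norm_of_nonneg (Real.exp_pos _).le]
  calc ‖g z‖ * Real.exp (-sqLen z)
      ≤ C * Real.exp (1 / 2 * sqLen z) * Real.exp (-sqLen z) := by gcongr; exact hC z
    _ = C * Real.exp (-(1 / 2 * sqLen z)) := by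
      rw [mul_assoc, ← Real.exp_add]
      congr 2
      ring

/-- The product `∏ᵢ |vᵢ† z|²`. -/
noncomputable def prodNormSq (V : Matrix κ ι ℂ) (z : ι → ℂ) : ℝ := ∏ i, ‖star (V i) ⬝ᵥ z‖ ^ 2

theorem ofReal_prodNormSq (V : Matrix κ ι ℂ) (z : ι → ℂ) :
    (prodNormSq V z : ℂ) = ∏ i, (star (V i) ⬝ᵥ z) * star (star (V i) ⬝ᵥ z) := by
  rw [prodNormSq]
  push_cast
  refine Finset.prod_congr rfl fun i _ => ?_
  rw [Complex.star_def, Complex.mul_conj, Complex.normSq_eq_norm_sq]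
  push_cast
  rfl

theorem subExpSq_prodNormSq (V : Matrix κ ι ℂ) : SubExpSq fun z => (prodNormSq V z : ℂ) := by
  simp_rw [ofReal_prodNormSq]
  exact SubExpSq.prod _ fun i => (SubExpSq.dotProduct _).mul (SubExpSq.dotProduct _).star

/-- Wick's formula: the Gaussian average of `∏ᵢ |vᵢ† z|²` is a permanent. -/
theorem integral_prodNormSq [DecidableEq κ] (V : Matrix κ ι ℂ) :
    ∫ z : ι → ℂ, (prodNormSq V z : ℂ) * (Real.exp (-sqLen z) : ℂ) =
      (V * Vᴴ).permanent * (Real.pi : ℂ) ^ Fintype.card ι := by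
  classical
  have h : ∀ z : ι → ℂ, (prodNormSq V z : ℂ) * (Real.exp (-sqLen z) : ℂ) =
      ∑ a : κ → ι, ∑ b : κ → ι, ((∏ i, star (V i (a i))) * ∏ i, V i (b i)) *
        ((∏ i, z (a i)) * (∏ i, star (z (b i))) * (Real.exp (-sqLen z) : ℂ)) := by
    intro z
    rw [ofReal_prodNormSq, Finset.prod_mul_distrib]
    simp only [dotProduct, star_sum, star_mul', Pi.star_apply, star_star, Finset.prod_univ_sum,
      Fintype.piFinset_univ, Finset.prod_mul_distrib, Finset.sum_mul]
    refine Finset.sum_congr rfl fun a _ => ?_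
    rw [Finset.mul_sum, Finset.sum_mul]
    refine Finset.sum_congr rfl fun b _ => ?_
    ring
  have hint : ∀ a b : κ → ι, Integrable fun z : ι → ℂ =>
      ((∏ i, star (V i (a i))) * ∏ i, V i (b i)) *
        ((∏ i, z (a i)) * (∏ i, star (z (b i))) * (Real.exp (-sqLen z) : ℂ)) := fun a b =>
    (((SubExpSq.prod _ fun i => SubExpSq.coord (a i)).mul
      (SubExpSq.prod _ fun i => (SubExpSq.coord (b i)).star)).integrable).const_mul _
  simp_rw [h]
  rw [integral_finsetSum _ fun a _ => integrable_finsetSum _ fun b _ => hint a b]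
  simp_rw [integral_finsetSum _ fun b _ => hint _ b, integral_const_mul,
    integral_monomial_mul_exp_neg_sqLen, ← mul_assoc, ← Finset.sum_mul]
  congr 1
  simp only [permanent, mul_apply, conjTranspose_apply, Finset.prod_univ_sum,
    Fintype.piFinset_univ, Finset.prod_mul_distrib]
  rw [Finset.sum_comm]
  simp_rw [Fintype.card_subtype, Finset.card_filter, Nat.cast_sum, Finset.mul_sum]
  conv_lhs =>
    enter [2, b]
    rw [Finset.sum_comm]
  rw [Finset.sum_comm]
  refine Finset.sum_congr rfl fun σ _ => ?_
  simp only [Nat.cast_ite, Nat.cast_one, Nat.cast_zero, mul_ite, mul_one, mul_zero,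
    Finset.sum_ite_eq, Finset.mem_univ, if_true]
  rw [← Equiv.sum_comp (Equiv.arrowCongr σ (Equiv.refl ι))]
  refine Finset.sum_congr rfl fun c _ => ?_
  rw [← Equiv.prod_comp σ fun i => V i (Equiv.arrowCongr σ (Equiv.refl ι) c i)]
  simp [Equiv.arrowCongr, mul_comm]

theorem integral_prodNormSq_pos (V : Matrix κ ι ℂ) (hV : ∀ i, V i ≠ 0) :
    0 < ∫ z : ι → ℂ, prodNormSq V z * Real.exp (-sqLen z) := by
  obtain ⟨z, hz⟩ : ∃ z : ι → ℂ, ∀ i, star (V i) ⬝ᵥ z ≠ 0 := by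
    by_contra! hcon
    let p : κ → Subspace ℂ (ι → ℂ) := fun i => LinearMap.ker
      ({ toFun := fun z => star (V i) ⬝ᵥ z
         map_add' := dotProduct_add _
         map_smul' := fun c z => dotProduct_smul c _ z } : (ι → ℂ) →ₗ[ℂ] ℂ)
    obtain ⟨i, hi⟩ := Subspace.exists_eq_top_of_iUnion_eq_univ (p := p)
      (Set.eq_univ_of_forall fun z => Set.mem_iUnion.mpr (hcon z))
    have : V i ∈ p i := hi ▸ Submodule.mem_top
    exact hV i (dotProduct_star_self_eq_zero.mp this)
  have hint := (subExpSq_prodNormSq V).integrable.re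
  have hcont : Continuous fun z => prodNormSq V z * Real.exp (-sqLen z) := by
    have := continuous_sqLen (ι := ι)
    unfold prodNormSq dotProduct
    fun_prop
  refine integral_pos_of_integrable_nonneg_nonzero (x := z) hcont ?_ ?_ ?_
  · refine hint.congr (Filter.Eventually.of_forall fun z => ?_)
    simp only [← Complex.ofReal_mul]
    exact Complex.ofReal_re _
  · intro z
    exact mul_nonneg (Finset.prod_nonneg fun i _ => sq_nonneg _) (Real.exp_pos _).le
  · exact mul_ne_zero (Finset.prod_ne_zero_iff.mpr fun i _ =>
      pow_ne_zero _ (norm_ne_zero_iff.mpr (hz i))) (Real.exp_pos _).ne'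

/-- The second moments `∫ g(z) zⱼ conj(zₖ) exp(-|z|²) dz`. -/
noncomputable def momentMatrix (g : (ι → ℂ) → ℂ) : Matrix ι ι ℂ :=
  Matrix.of fun j k => ∫ z : ι → ℂ, g z * (z j * star (z k)) * (Real.exp (-sqLen z) : ℂ)

theorem integral_quadratic {g : (ι → ℂ) → ℂ} (hg : SubExpSq g) (M : Matrix ι ι ℂ) :
    ∫ z : ι → ℂ, g z * (star z ⬝ᵥ M *ᵥ z) * (Real.exp (-sqLen z) : ℂ) =
      (M * momentMatrix g).trace := by
  have h : ∀ z : ι → ℂ, g z * (star z ⬝ᵥ M *ᵥ z) * (Real.exp (-sqLen z) : ℂ) =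
      ∑ j, ∑ k, M j k * (g z * (z k * star (z j)) * (Real.exp (-sqLen z) : ℂ)) := by
    intro z
    simp only [dotProduct, mulVec, Pi.star_apply, Finset.mul_sum, Finset.sum_mul]
    refine Finset.sum_congr rfl fun a _ => Finset.sum_congr rfl fun b _ => ?_
    ring
  have hint : ∀ j k : ι, Integrable fun z : ι → ℂ =>
      M j k * (g z * (z k * star (z j)) * (Real.exp (-sqLen z) : ℂ)) := fun j k =>
    (hg.mul ((SubExpSq.coord k).mul (SubExpSq.coord j).star)).integrable.const_mul _
  simp_rw [h]
  rw [integral_finsetSum _ fun a _ => integrable_finsetSum _ fun b _ => hint a b]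
  simp_rw [integral_finsetSum _ fun b _ => hint _ b, integral_const_mul]
  simp [Matrix.trace, mul_apply, momentMatrix]

theorem star_dotProduct_vecMulVec_mulVec (c z : ι → ℂ) :
    star z ⬝ᵥ vecMulVec c (star c) *ᵥ z = ((‖star c ⬝ᵥ z‖ ^ 2 : ℝ) : ℂ) := by
  rw [vecMulVec_mulVec, dotProduct_smul, ← Complex.normSq_eq_norm_sq, ← Complex.mul_conj,
    ← Complex.star_def, star_dotProduct, star_star]
  simp [dotProduct_comm, mul_comm]

theorem trace_vecMulVec_star_mul (c : ι → ℂ) (M : Matrix ι ι ℂ) :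
    (vecMulVec c (star c) * M).trace = star c ⬝ᵥ M *ᵥ c := by
  rw [vecMulVec_mul, trace_vecMulVec, dotProduct_mulVec, dotProduct_comm]

theorem posDef_momentMatrix (V : Matrix κ ι ℂ) (hV : ∀ i, V i ≠ 0) :
    (momentMatrix fun z => (prodNormSq V z : ℂ)).PosDef := by
  refine PosDef.of_dotProduct_mulVec_pos ?_ fun c hc => ?_
  · ext j k
    simp only [momentMatrix, conjTranspose_apply, of_apply, Complex.star_def]
    rw [← integral_conj]
    congr 1
    funext z
    simp only [map_mul, Complex.conj_conj, Complex.conj_ofReal]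
    ring
  · rw [← trace_vecMulVec_star_mul, ← integral_quadratic (subExpSq_prodNormSq V)]
    simp_rw [star_dotProduct_vecMulVec_mulVec, ← Complex.ofReal_mul]
    rw [integral_complex_ofReal]
    have := integral_prodNormSq_pos (Matrix.of fun o : Option κ => o.elim c V)
      (by rintro (_ | i); exacts [hc, hV i])
    have h : ∀ z, prodNormSq (Matrix.of fun o : Option κ => o.elim c V) z =
        prodNormSq V z * ‖star c ⬝ᵥ z‖ ^ 2 := by
      intro z
      rw [prodNormSq, Fintype.prod_option, mul_comm]
      rfl
    simp_rw [h] at this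
    exact_mod_cast this

theorem sqLen_eq_dotProduct (z : ι → ℂ) : star z ⬝ᵥ z = (sqLen z : ℂ) := by
  simp [sqLen, dotProduct, Complex.conj_mul']

theorem integral_exp_neg_sqLen :
    ∫ z : ι → ℂ, Real.exp (-sqLen z) = Real.pi ^ Fintype.card ι := by
  have h := integral_prodNormSq (0 : Matrix (Fin 0) ι ℂ)
  simp only [prodNormSq, ← Complex.ofReal_mul] at h
  rw [integral_complex_ofReal] at h
  simp only [Finset.univ_eq_empty, Finset.prod_empty, one_mul, permanent_isEmpty] at h
  exact_mod_cast h

/-- A positive definite matrix is of the form `Bᴴ * B`. -/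
theorem Matrix.PosDef.exists_eq_conjTranspose_mul_self {X : Matrix ι ι ℂ} (hX : X.PosDef) :
    ∃ B : Matrix ι ι ℂ, X = Bᴴ * B := by
  classical
  open scoped MatrixOrder in
  exact CStarAlgebra.nonneg_iff_eq_star_mul_self.mp hX.posSemidef.nonneg

theorem Matrix.PosDef.det_re_pos [DecidableEq ι] {X : Matrix ι ι ℂ} (hX : X.PosDef) :
    0 < X.det.re :=
  (Complex.lt_def.mp hX.det_pos).1

/-- Gaussian integral of a positive definite Hermitian form. -/
theorem integral_exp_neg_quadratic [DecidableEq ι] {X : Matrix ι ι ℂ} (hX : X.PosDef) :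
    Integrable (fun z : ι → ℂ => Real.exp (-(star z ⬝ᵥ X⁻¹ *ᵥ z).re)) ∧
    ∫ z : ι → ℂ, Real.exp (-(star z ⬝ᵥ X⁻¹ *ᵥ z).re) =
      X.det.re * Real.pi ^ Fintype.card ι := by
  obtain ⟨B, hB⟩ : ∃ B : Matrix ι ι ℂ, X⁻¹ = Bᴴ * B :=
    hX.inv.exists_eq_conjTranspose_mul_self
  have hq : ∀ z, (star z ⬝ᵥ X⁻¹ *ᵥ z).re = sqLen (B.mulVecLin z) := by
    intro z
    rw [hB, ← mulVec_mulVec, dotProduct_mulVec, ← star_mulVec, sqLen_eq_dotProduct]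
    rfl
  have hXdet : X.det = (X.det.re : ℂ) := by
    have := hX.det_pos
    rw [Complex.lt_def] at this
    apply Complex.ext <;> simp [this.2.symm]
  have hpos := hX.det_re_pos
  have hBdet : X.det.re * Complex.normSq B.det = 1 := by
    have h1 : X.det * (X⁻¹).det = 1 := by
      rw [← det_mul, mul_nonsing_inv _ hX.det_pos.ne'.isUnit, det_one]
    rw [hB, det_mul, det_conjTranspose, Complex.star_def, ← Complex.normSq_eq_conj_mul_self,
      hXdet] at h1
    exact_mod_cast h1
  have hf : LinearMap.det (B.mulVecLin.restrictScalars ℝ) = Complex.normSq B.det := by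
    rw [LinearMap.det_restrictScalars, Algebra.norm_complex_apply, ← toLin'_apply',
      LinearMap.det_toLin']
  have hf0 : LinearMap.det (B.mulVecLin.restrictScalars ℝ) ≠ 0 := by
    rw [hf]
    exact right_ne_zero_of_mul_eq_one hBdet
  have hmap := Measure.map_linearMap_addHaar_eq_smul_addHaar
    (volume : Measure (ι → ℂ)) hf0
  have hinv : (LinearMap.det (B.mulVecLin.restrictScalars ℝ))⁻¹ = X.det.re := by
    rw [hf]
    exact inv_eq_of_mul_eq_one_left hBdet
  rw [hinv, abs_of_pos hpos] at hmap
  have hme : AEMeasurable (B.mulVecLin.restrictScalars ℝ) (volume : Measure (ι → ℂ)) :=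
    (LinearMap.continuous_of_finiteDimensional _).measurable.aemeasurable
  have hint : Integrable fun z : ι → ℂ => Real.exp (-sqLen z) := by
    simpa using integrable_exp_neg_mul_sqLen (ι := ι) one_pos
  have hint' : Integrable (fun z : ι → ℂ => Real.exp (-sqLen z))
      (Measure.map (B.mulVecLin.restrictScalars ℝ) volume) := by
    rw [hmap]
    exact hint.smul_measure ENNReal.ofReal_ne_top
  simp_rw [hq]
  refine ⟨(integrable_map_measure hint'.aestronglyMeasurable hme).mp hint', ?_⟩
  have h := integral_map hme hint'.aestronglyMeasurable
  rw [hmap, integral_smul_measure, integral_exp_neg_sqLen,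
    ENNReal.toReal_ofReal hpos.le, smul_eq_mul] at h
  exact h.symm

theorem prodNormSq_le {u : κ → ℝ} (hu : ∀ i, 0 < u i) (V : Matrix κ ι ℂ) (z : ι → ℂ) :
    prodNormSq V z ≤ (∏ i, u i) * Real.exp (∑ i, (‖star (V i) ⬝ᵥ z‖ ^ 2 / u i - 1)) := by
  rw [prodNormSq, Real.exp_sum, ← Finset.prod_mul_distrib]
  refine Finset.prod_le_prod (fun i _ => sq_nonneg _) fun i _ => ?_
  have h := Real.add_one_le_exp (‖star (V i) ⬝ᵥ z‖ ^ 2 / u i - 1)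
  rw [sub_add_cancel, div_le_iff₀ (hu i)] at h
  linarith

theorem Matrix.PosDef.ofReal_re_dotProduct {X : Matrix ι ι ℂ} (hX : X.PosDef) (v : ι → ℂ) :
    (((star v ⬝ᵥ X *ᵥ v).re : ℝ) : ℂ) = star v ⬝ᵥ X *ᵥ v := by
  have h := hX.posSemidef.dotProduct_mulVec_nonneg v
  rw [Complex.le_def] at h
  apply Complex.ext <;> simp [h.2.symm]

theorem Matrix.PosDef.re_dotProduct_mulVec_pos {X : Matrix ι ι ℂ} (hX : X.PosDef)
    {v : ι → ℂ} (hv : v ≠ 0) : 0 < (star v ⬝ᵥ X *ᵥ v).re :=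
  (Complex.lt_def.mp (hX.dotProduct_mulVec_pos hv)).1

/-- Gibbs' variational principle, applied to the density `∏ᵢ |vᵢ† z|² exp(-|z|²)` and the centred
Gaussian with the same covariance. -/
theorem integral_prodNormSq_le [DecidableEq ι] (V : Matrix κ ι ℂ) (hV : ∀ i, V i ≠ 0) :
    ∃ X : Matrix ι ι ℂ, X.PosDef ∧
      ∫ z : ι → ℂ, prodNormSq V z * Real.exp (-sqLen z) ≤
        (∏ i, (star (V i) ⬝ᵥ X *ᵥ V i).re) * Real.exp (Fintype.card ι - X.trace.re) *
          (X.det.re * Real.pi ^ Fintype.card ι) := by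
  set Z : ℝ := ∫ z : ι → ℂ, prodNormSq V z * Real.exp (-sqLen z) with hZ
  have hZpos : 0 < Z := integral_prodNormSq_pos V hV
  set Y := momentMatrix fun z => (prodNormSq V z : ℂ) with hY
  have hf := subExpSq_prodNormSq V
  obtain ⟨X, hXY⟩ : ∃ X : Matrix ι ι ℂ, Y = (Z : ℂ) • X :=
    ⟨(Z : ℂ)⁻¹ • Y, by rw [smul_inv_smul₀ (by exact_mod_cast hZpos.ne')]⟩
  have hX : X.PosDef := by
    have h : X = (Z : ℂ)⁻¹ • Y := by
      rw [hXY, inv_smul_smul₀ (by exact_mod_cast hZpos.ne')]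
    rw [h]
    exact (posDef_momentMatrix V hV).smul (inv_pos.mpr (by exact_mod_cast hZpos))
  refine ⟨X, hX, ?_⟩
  set u : κ → ℝ := fun i => (star (V i) ⬝ᵥ X *ᵥ V i).re with hu
  have hupos : ∀ i, 0 < u i := fun i => hX.re_dotProduct_mulVec_pos (hV i)
  let M : Matrix ι ι ℂ := 1 - X⁻¹ - ∑ i, ((u i)⁻¹ : ℂ) • vecMulVec (V i) (star (V i))
  let c : ℝ := 1 + Fintype.card ι - X.trace.re + Fintype.card κ
  have htrX : X.trace = (X.trace.re : ℂ) := by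
    have h := hX.posSemidef.trace_nonneg
    rw [Complex.le_def] at h
    apply Complex.ext <;> simp [h.2.symm]
  have htr : (M * X).trace = X.trace - Fintype.card ι - Fintype.card κ := by
    simp only [M, sub_mul, one_mul, trace_sub, nonsing_inv_mul _ hX.det_pos.ne'.isUnit,
      trace_one, Finset.sum_mul, trace_sum, smul_mul_assoc, trace_smul, trace_vecMulVec_star_mul]
    congr 1
    rw [← Finset.card_univ (α := κ), Finset.cast_card]
    refine Finset.sum_congr rfl fun i _ => ?_
    rw [← hX.ofReal_re_dotProduct, smul_eq_mul]
    exact inv_mul_cancel₀ (by exact_mod_cast (hupos i).ne')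
  have hq : ∀ z : ι → ℂ, (star z ⬝ᵥ M *ᵥ z).re =
      sqLen z - (star z ⬝ᵥ X⁻¹ *ᵥ z).re - ∑ i, ‖star (V i) ⬝ᵥ z‖ ^ 2 / u i := by
    intro z
    simp only [M, sub_mulVec, one_mulVec, dotProduct_sub, sqLen_eq_dotProduct, sum_mulVec,
      dotProduct_sum, smul_mulVec, dotProduct_smul, star_dotProduct_vecMulVec_mulVec,
      Complex.sub_re, Complex.ofReal_re, Complex.re_sum, smul_eq_mul]
    congr 1
    refine Finset.sum_congr rfl fun i _ => ?_
    rw [← Complex.ofReal_inv, ← Complex.ofReal_mul, Complex.ofReal_re, div_eq_inv_mul]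
  have hint1 := (hf.mul (SubExpSq.quadratic M)).integrable
  have hint2 := hf.integrable.const_mul (c : ℂ)
  have hZC : ∫ z : ι → ℂ, (prodNormSq V z : ℂ) * (Real.exp (-sqLen z) : ℂ) = Z := by
    simp_rw [← Complex.ofReal_mul]
    rw [integral_complex_ofReal]
  have hre : ∀ z : ι → ℂ, ((prodNormSq V z : ℂ) * (star z ⬝ᵥ M *ᵥ z) * (Real.exp (-sqLen z) : ℂ) +
      c * ((prodNormSq V z : ℂ) * (Real.exp (-sqLen z) : ℂ))).re =
      prodNormSq V z * Real.exp (-sqLen z) * (c + (star z ⬝ᵥ M *ᵥ z).re) := by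
    intro z
    simp only [Complex.add_re, Complex.re_mul_ofReal, Complex.re_ofReal_mul, Complex.ofReal_re]
    ring
  have hZint : ∫ z : ι → ℂ, prodNormSq V z * Real.exp (-sqLen z) * (c + (star z ⬝ᵥ M *ᵥ z).re) =
      Z := by
    simp_rw [← hre]
    have h := integral_re (hint1.add hint2)
    simp only [Pi.add_apply, RCLike.re_eq_complex_re] at h
    rw [h, integral_add hint1 hint2, integral_const_mul, hZC, integral_quadratic hf, ← hY, hXY,
      Matrix.mul_smul, trace_smul, htr, htrX]
    simp only [c]
    simp
    ring
  obtain ⟨hintG, hG⟩ := integral_exp_neg_quadratic hX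
  rw [← hZint, ← hG, ← integral_const_mul]
  refine integral_mono ?_ (hintG.const_mul _) fun z => ?_
  · simp_rw [← hre]
    exact (hint1.add hint2).re
  · have h1 := prodNormSq_le hupos V z
    have h2 := Real.add_one_le_exp (c + (star z ⬝ᵥ M *ᵥ z).re - 1)
    rw [sub_add_cancel] at h2
    have h0 : 0 ≤ prodNormSq V z := Finset.prod_nonneg fun i _ => sq_nonneg _
    calc prodNormSq V z * Real.exp (-sqLen z) * (c + (star z ⬝ᵥ M *ᵥ z).re)
        ≤ ((∏ i, u i) * Real.exp (∑ i, (‖star (V i) ⬝ᵥ z‖ ^ 2 / u i - 1))) *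
            Real.exp (-sqLen z) * Real.exp (c + (star z ⬝ᵥ M *ᵥ z).re - 1) :=
          (mul_le_mul_of_nonneg_left h2 (mul_nonneg h0 (Real.exp_pos _).le)).trans
            (by gcongr)
      _ = _ := by
        simp only [mul_assoc, ← Real.exp_add]
        congr 2
        rw [hq, Finset.sum_sub_distrib]
        simp [c]
        ring

theorem sqLen_pos {v : ι → ℂ} (hv : v ≠ 0) : 0 < sqLen v := by
  obtain ⟨j, hj⟩ := Function.ne_iff.mp hv
  exact Finset.sum_pos' (fun _ _ => sq_nonneg _)
    ⟨j, Finset.mem_univ j, pow_pos (norm_pos_iff.mpr hj) 2⟩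

theorem re_dotProduct_mulVec_le_sqLen_mul_trace {X : Matrix ι ι ℂ} (hX : X.PosDef) (v : ι → ℂ) :
    (star v ⬝ᵥ X *ᵥ v).re ≤ sqLen v * X.trace.re := by
  obtain ⟨B, rfl⟩ : ∃ B : Matrix ι ι ℂ, X = Bᴴ * B :=
    hX.exists_eq_conjTranspose_mul_self
  have htr : (Bᴴ * B).trace.re = ∑ i, sqLen (B i) := by
    simp only [Matrix.trace, diag_apply, mul_apply, conjTranspose_apply, Complex.re_sum, sqLen,
      Complex.star_def, Complex.conj_mul', ← Complex.ofReal_pow, Complex.ofReal_re]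
    exact Finset.sum_comm
  rw [← mulVec_mulVec, dotProduct_mulVec, ← star_mulVec, sqLen_eq_dotProduct, Complex.ofReal_re,
    htr, Finset.mul_sum]
  refine Finset.sum_le_sum fun i _ => ?_
  calc ‖(B *ᵥ v) i‖ ^ 2 ≤ (∑ j, ‖v j‖ * ‖B i j‖) ^ 2 := by
        gcongr
        refine (norm_sum_le _ _).trans (Finset.sum_le_sum fun j _ => ?_)
        rw [norm_mul, mul_comm]
    _ ≤ _ := Finset.sum_mul_sq_le_sq_mul_sq _ _ _

theorem log_le_div_add_log_sub_one {x K : ℝ} (hx : 0 < x) (hK : 0 < K) :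
    Real.log x ≤ x / K + (Real.log K - 1) := by
  have h := Real.log_le_sub_one_of_pos (div_pos hx hK)
  rw [Real.log_div hx.ne' hK.ne'] at h
  linarith

theorem log_det_re_le [DecidableEq ι] {X : Matrix ι ι ℂ} (hX : X.PosDef) :
    Real.log X.det.re ≤ X.trace.re / 2 + Fintype.card ι * (Real.log 2 - 1) := by
  rw [hX.1.det_eq_prod_eigenvalues, hX.1.trace_eq_sum_eigenvalues]
  have h1 : (∏ i, (hX.1.eigenvalues i : ℂ)).re = ∏ i, hX.1.eigenvalues i := by
    rw [← Complex.ofReal_prod, Complex.ofReal_re]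
  have h2 : (∑ i, (hX.1.eigenvalues i : ℂ)).re = ∑ i, hX.1.eigenvalues i := by
    rw [← Complex.ofReal_sum, Complex.ofReal_re]
  erw [h1, h2]
  rw [Real.log_prod fun i _ => (hX.eigenvalues_pos i).ne', Finset.sum_div, ← Finset.card_univ,
    ← nsmul_eq_mul, ← Finset.sum_const, ← Finset.sum_add_distrib]
  exact Finset.sum_le_sum fun i _ => log_le_div_add_log_sub_one (hX.eigenvalues_pos i) two_pos

end GaussianIntegrals

theorem bddAbove_phiV {n d : ℕ} (V : Matrix (Fin n) (Fin d) ℂ) (hV : ∀ i, V i ≠ 0) :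
    BddAbove {r : ℝ | ∃ X : Matrix (Fin d) (Fin d) ℂ, X.PosDef ∧ r = phiV V X} := by
  refine ⟨∑ i, (Real.log (2 * (n + 1) * sqLen (V i)) - 1) + d * (Real.log 2 - 1) + d, ?_⟩
  rintro _ ⟨X, hX, rfl⟩
  have ht : 0 ≤ X.trace.re := (Complex.le_def.mp hX.posSemidef.trace_nonneg).1
  have hdet := log_det_re_le hX
  have hlog : ∀ i, Real.log ((star (V i) ⬝ᵥ X *ᵥ V i).re) ≤
      X.trace.re / (2 * (n + 1)) + (Real.log (2 * (n + 1) * sqLen (V i)) - 1) := by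
    intro i
    have hs := sqLen_pos (hV i)
    refine (log_le_div_add_log_sub_one (hX.re_dotProduct_mulVec_pos (hV i))
      (K := 2 * (n + 1) * sqLen (V i)) (by positivity)).trans ?_
    refine add_le_add_left ?_ _
    rw [div_le_div_iff₀ (by positivity) (by positivity)]
    have := re_dotProduct_mulVec_le_sqLen_mul_trace hX (V i)
    calc _ ≤ sqLen (V i) * X.trace.re * (2 * (n + 1)) := by gcongr
      _ = _ := by ring
  have hsum := Finset.sum_le_sum fun i (_ : i ∈ Finset.univ) => hlog i
  rw [Finset.sum_add_distrib, Finset.sum_const, Finset.card_univ, Fintype.card_fin,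
    nsmul_eq_mul] at hsum
  have hfrac : (n : ℝ) * (X.trace.re / (2 * (n + 1))) ≤ X.trace.re / 2 := by
    rw [← mul_div_assoc, div_le_div_iff₀ (by positivity) (by positivity)]
    nlinarith
  rw [Fintype.card_fin] at hdet
  rw [phiV]
  linarith

theorem exp_phiV {n d : ℕ} (V : Matrix (Fin n) (Fin d) ℂ) (hV : ∀ i, V i ≠ 0)
    {X : Matrix (Fin d) (Fin d) ℂ} (hX : X.PosDef) :
    Real.exp (phiV V X) =
      (∏ i, (star (V i) ⬝ᵥ X *ᵥ V i).re) * Real.exp (d - X.trace.re) * X.det.re := by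
  have h : phiV V X = ∑ i, Real.log ((star (V i) ⬝ᵥ X *ᵥ V i).re) + (d - X.trace.re) +
      Real.log X.det.re := by
    rw [phiV]
    ring
  rw [h, Real.exp_add, Real.exp_add, Real.exp_sum, Real.exp_log hX.det_re_pos]
  simp_rw [Real.exp_log (hX.re_dotProduct_mulVec_pos (hV _))]

theorem stmt1 {n d : ℕ} (A : Matrix (Fin n) (Fin n) ℂ) (V : Matrix (Fin n) (Fin d) ℂ)
    (hfact : A = V * Vᴴ) (hV : V.rank = d) (hrows : ∀ i, V i ≠ 0) :
    A.permanent ≤ (Real.exp (PhiV V) : ℂ) := by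
  obtain ⟨X, hX, hle⟩ := integral_prodNormSq_le V hrows
  have hpi : (0 : ℝ) < Real.pi ^ d := by positivity
  have hwick := integral_prodNormSq V
  simp_rw [← Complex.ofReal_mul] at hwick
  rw [integral_complex_ofReal, ← hfact, Fintype.card_fin] at hwick
  rw [Fintype.card_fin, ← mul_assoc, ← exp_phiV V hrows hX, ← div_le_iff₀ hpi] at hle
  have hper : A.permanent =
      (((∫ z, prodNormSq V z * Real.exp (-sqLen z)) / Real.pi ^ d : ℝ) : ℂ) := by
    rw [Complex.ofReal_div, hwick, Complex.ofReal_pow, mul_div_cancel_right₀]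
    exact pow_ne_zero _ (by exact_mod_cast Real.pi_ne_zero)
  rw [hper]
  refine Complex.real_le_real.mpr (hle.trans (Real.exp_le_exp.mpr ?_))
  exact le_csSup (bddAbove_phiV V hrows) ⟨X, hX, rfl⟩
end

section
/- Let A = V V† be an n×n Hermitian positive semidefinite matrix, where V ∈ ℂ^{n×d} has full column rank and rows v₁,…,vₙ, all nonzero. Then for every Hermitian positive definite d×d matrix X, per(A) ≥ exp(∑_{i=1}^n log(vᵢ† X vᵢ) + log det X − tr X + d − γn), where γ is the Euler–Mascheroni constant. -/
open MeasureTheory Matrix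
open scoped ComplexOrder

namespace ComplexGaussian

open Set Filter Topology
open scoped Nat ComplexConjugate

theorem integrable_comp_norm_sq_iff {f : ℝ → ℝ} :
    Integrable (fun z : ℂ ↦ f (‖z‖ ^ 2)) ↔ IntegrableOn f (Ioi 0) := by
  rw [integrable_fun_norm_addHaar (F := ℝ) (volume : Measure ℂ) (f := fun r ↦ f (r ^ 2)),
    Complex.finrank_real_complex, ← integrableOn_Ioi_comp_rpow_iff' f two_ne_zero]
  norm_num

theorem integral_comp_norm_sq (f : ℝ → ℝ) :
    ∫ z : ℂ, f (‖z‖ ^ 2) = Real.pi * ∫ t in Ioi 0, f t := by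
  rw [integral_fun_norm_addHaar (F := ℝ) (volume : Measure ℂ) (fun r ↦ f (r ^ 2)),
    Complex.finrank_real_complex, ← integral_comp_rpow_Ioi_of_pos (g := f) two_pos]
  have : (volume : Measure ℂ).real (Metric.ball 0 1) = Real.pi := by
    simp [Measure.real]
  rw [this]
  norm_num [mul_assoc, integral_const_mul]
  ring

theorem integrableOn_log_mul_exp_neg :
    IntegrableOn (fun t : ℝ ↦ Real.log t * Real.exp (-t)) (Ioi 0) ∧
      ∫ t in Ioi 0, Real.log t * Real.exp (-t) = -Real.eulerMascheroniConstant := by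
  have key : MellinConvergent (fun t : ℝ ↦ Real.log t • (Real.exp (-t) : ℂ)) (1 : ℂ) := by
    refine (mellin_hasDerivAt_of_isBigO_rpow (E := ℂ) (a := 2) (b := 0) ?_ ?_ (by simp) ?_
      (by simp)).1
    · refine (Continuous.continuousOn ?_).locallyIntegrableOn measurableSet_Ioi
      fun_prop
    · rw [← Asymptotics.isBigO_norm_left]
      simp_rw [Complex.norm_real, Asymptotics.isBigO_norm_left]
      simpa only [neg_one_mul] using (isLittleO_exp_neg_mul_rpow_atTop zero_lt_one _).isBigO
    · simp_rw [neg_zero, Real.rpow_zero]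
      refine Asymptotics.isBigO_const_of_tendsto (y := (1 : ℂ)) ?_ one_ne_zero
      have : Continuous fun t : ℝ ↦ (Real.exp (-t) : ℂ) := by fun_prop
      simpa using (this.tendsto 0).mono_left nhdsWithin_le_nhds
  constructor
  · rw [MellinConvergent] at key
    have := key.re
    refine this.congr (ae_of_all _ fun t ↦ ?_)
    simp [-Complex.ofReal_exp]
  · have h1 := (Complex.hasDerivAt_GammaIntegral (s := 1) (by simp)).congr_of_eventuallyEq
      (f₁ := Complex.Gamma) (by
        filter_upwards [(Complex.continuous_re.tendsto 1).eventually (lt_mem_nhds (a := 0) (by simp))]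
          with s hs
        exact Complex.Gamma_eq_integral hs)
    have h2 := h1.unique Complex.hasDerivAt_Gamma_one
    rw [← Complex.ofReal_inj, ← integral_complex_ofReal]
    push_cast
    rw [← h2]
    simp

/-- The density of the standard complex normal distribution on `ℂ`. -/
noncomputable def pdf (z : ℂ) : ℝ := Real.pi⁻¹ * Real.exp (-‖z‖ ^ 2)

theorem continuous_pdf : Continuous pdf := by
  unfold pdf
  fun_prop

theorem integral_log_norm_sq_mul_pdf :
    Integrable (fun z : ℂ ↦ Real.log (‖z‖ ^ 2) * pdf z) ∧
      ∫ z : ℂ, Real.log (‖z‖ ^ 2) * pdf z = -Real.eulerMascheroniConstant := by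
  have h : (fun z : ℂ ↦ Real.log (‖z‖ ^ 2) * pdf z) =
      fun z : ℂ ↦ (fun t : ℝ ↦ Real.pi⁻¹ * (Real.log t * Real.exp (-t))) (‖z‖ ^ 2) := by
    ext z
    simp only [pdf]
    ring
  rw [h]
  refine ⟨integrable_comp_norm_sq_iff.2 (integrableOn_log_mul_exp_neg.1.const_mul _), ?_⟩
  rw [integral_comp_norm_sq (fun t ↦ Real.pi⁻¹ * (Real.log t * Real.exp (-t))),
    integral_const_mul, integrableOn_log_mul_exp_neg.2]
  field_simp

theorem integrable_norm_pow_mul_pdf (m : ℕ) : Integrable (fun z : ℂ ↦ ‖z‖ ^ m * pdf z) := by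
  have h : (fun z : ℂ ↦ ‖z‖ ^ m * pdf z) =
      fun z : ℂ ↦ (fun t : ℝ ↦ Real.pi⁻¹ * (Real.exp (-t) * t ^ (((m : ℝ) / 2 + 1) - 1)))
        (‖z‖ ^ 2) := by
    ext z
    have : (‖z‖ ^ 2) ^ ((m : ℝ) / 2) = ‖z‖ ^ m := by
      rw [← Real.rpow_natCast, ← Real.rpow_mul (norm_nonneg z), ← Real.rpow_natCast]
      congr 1
      push_cast
      ring
    simp only [pdf, add_sub_cancel_right, this]
    ring
  rw [h]
  exact integrable_comp_norm_sq_iff.2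
    ((Real.GammaIntegral_convergent (by positivity)).const_mul _)

theorem integral_norm_sq_pow_mul_pdf (m : ℕ) : ∫ z : ℂ, (‖z‖ ^ 2) ^ m * pdf z = m ! := by
  have h : (fun z : ℂ ↦ (‖z‖ ^ 2) ^ m * pdf z) =
      fun z : ℂ ↦ (fun t : ℝ ↦ Real.pi⁻¹ * (Real.exp (-t) * t ^ (((m : ℝ) + 1) - 1)))
        (‖z‖ ^ 2) := by
    ext z
    simp only [pdf, add_sub_cancel_right, Real.rpow_natCast]
    ring
  rw [h, integral_comp_norm_sq
      (fun t ↦ Real.pi⁻¹ * (Real.exp (-t) * t ^ (((m : ℝ) + 1) - 1))),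
    integral_const_mul, ← Real.Gamma_eq_integral (by positivity),
    Real.Gamma_nat_eq_factorial]
  field_simp

theorem integrable_monomial_mul_pdf (a b : ℕ) :
    Integrable (fun z : ℂ ↦ z ^ a * conj z ^ b * (pdf z : ℂ)) := by
  refine (integrable_norm_pow_mul_pdf (a + b)).mono' ?_ (ae_of_all _ fun z ↦ ?_)
  · have := continuous_pdf
    exact Continuous.aestronglyMeasurable (by fun_prop)
  · have : 0 ≤ pdf z := by unfold pdf; positivity
    simp [pow_add, abs_of_nonneg this]

theorem integral_monomial_mul_pdf (a b : ℕ) :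
    ∫ z : ℂ, z ^ a * conj z ^ b * (pdf z : ℂ) = if a = b then (a ! : ℂ) else 0 := by
  split_ifs with hab
  · subst hab
    have h : (fun z : ℂ ↦ z ^ a * conj z ^ a * (pdf z : ℂ)) =
        fun z ↦ (((‖z‖ ^ 2) ^ a * pdf z : ℝ) : ℂ) := by
      ext z
      rw [← mul_pow, Complex.mul_conj, Complex.normSq_eq_norm_sq]
      push_cast
      ring
    rw [h, integral_complex_ofReal, integral_norm_sq_pow_mul_pdf]
    simp
  · set c : Circle := Circle.exp 1
    have hc := (LinearIsometryEquiv.measurePreserving (rotation c)).integral_comp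
      (rotation c).toHomeomorph.measurableEmbedding
      (fun z : ℂ ↦ z ^ a * conj z ^ b * (pdf z : ℂ))
    have h : ∀ z : ℂ, (rotation c z) ^ a * conj (rotation c z) ^ b * (pdf (rotation c z) : ℂ) =
        ((c : ℂ) ^ a * conj (c : ℂ) ^ b) * (z ^ a * conj z ^ b * (pdf z : ℂ)) := by
      intro z
      simp only [pdf, rotation_apply, norm_mul, Circle.norm_coe, one_mul, map_mul]
      ring
    simp_rw [h] at hc
    rw [integral_const_mul] at hc
    have hne : (c : ℂ) ^ a * conj (c : ℂ) ^ b ≠ 1 := by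
      intro h1
      have h2 : (c : ℂ) ^ a * conj (c : ℂ) ^ b = Complex.exp (((a : ℝ) - b : ℝ) * Complex.I) := by
        rw [Circle.coe_exp, ← Complex.exp_conj, ← Complex.exp_nat_mul, ← Complex.exp_nat_mul,
          ← Complex.exp_add]
        congr 1
        simp
        ring
      rw [h2, Complex.exp_eq_one_iff] at h1
      obtain ⟨n, hn⟩ := h1
      have h3 : ((a : ℝ) - b) = n * (2 * Real.pi) := by
        have := congrArg Complex.im hn
        simpa using this
      have hn0 : n ≠ 0 := by
        rintro rfl
        apply hab
        have : (a : ℝ) = b := by simpa [sub_eq_zero] using h3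
        exact_mod_cast this
      have hirr := irrational_pi
      apply hirr
      refine ⟨((a : ℚ) - b) / (2 * n), ?_⟩
      have : (n : ℝ) ≠ 0 := by exact_mod_cast hn0
      push_cast
      rw [h3]
      field_simp
    by_contra h0
    exact hne (mul_right_cancel₀ h0 (by simpa using hc))


variable {ι κ : Type*} [Fintype ι] [Fintype κ]

/-- The density of the standard complex normal distribution on `κ → ℂ`. -/
noncomputable def density (z : κ → ℂ) : ℝ := ∏ k, pdf (z k)

theorem density_nonneg (z : κ → ℂ) : 0 ≤ density z :=
  Finset.prod_nonneg fun _ _ ↦ by unfold pdf; positivity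

theorem density_eq (z : κ → ℂ) :
    density z = Real.pi⁻¹ ^ Fintype.card κ * Real.exp (-∑ k, ‖z k‖ ^ 2) := by
  simp [density, pdf, Finset.prod_mul_distrib, ← Real.exp_sum]

theorem card_perm_comp_eq [DecidableEq ι] [DecidableEq κ] (f g : ι → κ) :
    Fintype.card {σ : Equiv.Perm ι // f ∘ σ = g} =
      ∏ k, if Fintype.card {i // f i = k} = Fintype.card {i // g i = k}
        then (Fintype.card {i // f i = k})! else 0 := by
  by_cases h : ∀ k, Fintype.card {i // f i = k} = Fintype.card {i // g i = k}
  · simp only [h, if_true]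
    let σ₀ : Equiv.Perm ι := Equiv.ofFiberEquiv fun k ↦ (Fintype.equivOfCardEq (h k)).symm
    have hσ₀ : f ∘ σ₀ = g := funext fun i ↦ Equiv.ofFiberEquiv_map _ i
    rw [← DomMulAct.stabilizer_card g]
    refine Fintype.card_congr (Equiv.subtypeEquiv (Equiv.mulLeft σ₀⁻¹) fun σ ↦ ?_)
    have : g ∘ (σ₀⁻¹ * σ : Equiv.Perm ι) = f ∘ σ := by
      ext i
      simp [← hσ₀]
    rw [Equiv.coe_mulLeft, this]
  · push Not at h
    obtain ⟨k, hk⟩ := h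
    rw [Finset.prod_eq_zero (Finset.mem_univ k) (by simp [hk]), Fintype.card_eq_zero_iff]
    refine ⟨fun ⟨σ, hσ⟩ ↦ hk ?_⟩
    exact (Fintype.card_congr (Equiv.subtypeEquiv σ fun i ↦ by simp [← hσ])).symm

theorem prod_comp_eq_prod_pow_card [DecidableEq κ] (f : ι → κ) (z : κ → ℂ) :
    ∏ i, z (f i) = ∏ k, z k ^ Fintype.card {i // f i = k} := by
  rw [← Fintype.prod_fiberwise f]
  refine Finset.prod_congr rfl fun k _ ↦ ?_
  rw [Fintype.prod_congr _ (fun _ ↦ z k) (fun i ↦ by rw [i.2])]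
  simp

theorem monomial_mul_density_eq [DecidableEq κ] (f g : ι → κ) (z : κ → ℂ) :
    (∏ i, z (f i)) * (∏ i, conj (z (g i))) * (density z : ℂ) =
      ∏ k, (z k ^ Fintype.card {i // f i = k} * conj (z k) ^ Fintype.card {i // g i = k} *
        (pdf (z k) : ℂ)) := by
  rw [prod_comp_eq_prod_pow_card f z, prod_comp_eq_prod_pow_card g fun k ↦ conj (z k), density]
  push_cast
  rw [Finset.prod_mul_distrib, Finset.prod_mul_distrib]

theorem integrable_monomial_mul_density (f g : ι → κ) :
    Integrable fun z : κ → ℂ ↦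
      (∏ i, z (f i)) * (∏ i, conj (z (g i))) * (density z : ℂ) := by
  classical
  simp_rw [monomial_mul_density_eq]
  exact Integrable.fintype_prod fun k ↦ integrable_monomial_mul_pdf
    (Fintype.card {i // f i = k}) (Fintype.card {i // g i = k})

theorem integral_monomial_mul_density [DecidableEq ι] [DecidableEq κ] (f g : ι → κ) :
    ∫ z : κ → ℂ, (∏ i, z (f i)) * (∏ i, conj (z (g i))) * (density z : ℂ) =
      Fintype.card {σ : Equiv.Perm ι // f ∘ σ = g} := by
  simp_rw [monomial_mul_density_eq]
  rw [integral_fintype_prod_volume_eq_prod fun (k : κ) (z : ℂ) ↦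
    z ^ Fintype.card {i // f i = k} * conj z ^ Fintype.card {i // g i = k} * (pdf z : ℂ),
    card_perm_comp_eq]
  simp_rw [integral_monomial_mul_pdf]
  push_cast
  rfl

theorem permanent_mul_conjTranspose [DecidableEq ι] [DecidableEq κ] (V : Matrix ι κ ℂ) :
    (V * Vᴴ).permanent = ∑ f : ι → κ, ∑ g : ι → κ, (∏ i, V i (f i)) * (∏ i, conj (V i (g i))) *
      Fintype.card {σ : Equiv.Perm ι // f ∘ σ = g} := by
  have h : ∀ f g : ι → κ, (Fintype.card {σ : Equiv.Perm ι // f ∘ σ = g} : ℂ) =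
      ∑ σ : Equiv.Perm ι, if f ∘ σ = g then 1 else 0 := by
    intro f g
    simp [Fintype.card_subtype]
  simp_rw [h, Finset.mul_sum]
  simp_rw [Finset.sum_comm (s := (Finset.univ : Finset (ι → κ)))
    (t := (Finset.univ : Finset (Equiv.Perm ι)))]
  refine Finset.sum_congr rfl fun σ _ ↦ ?_
  simp only [mul_apply, conjTranspose_apply, Fintype.prod_sum, mul_ite, mul_one, mul_zero,
    Finset.sum_ite_eq, Finset.mem_univ, if_true]
  rw [← (Equiv.arrowCongr σ.symm (Equiv.refl κ)).sum_comp]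
  refine Finset.sum_congr rfl fun f _ ↦ ?_
  rw [Finset.prod_mul_distrib, ← Equiv.prod_comp σ fun i ↦ V i _]
  simp

theorem prod_norm_sq_mul_density_eq [DecidableEq ι] [DecidableEq κ] (V : Matrix ι κ ℂ) (z : κ → ℂ) :
    (((∏ i, ‖(V *ᵥ z) i‖ ^ 2) * density z : ℝ) : ℂ) =
      ∑ f : ι → κ, ∑ g : ι → κ, (∏ i, V i (f i)) * (∏ i, conj (V i (g i))) *
        ((∏ i, z (f i)) * (∏ i, conj (z (g i))) * (density z : ℂ)) := by
  have h : ∀ i, ((‖(V *ᵥ z) i‖ ^ 2 : ℝ) : ℂ) =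
      (∑ k, V i k * z k) * ∑ k, conj (V i k) * conj (z k) := by
    intro i
    rw [← Complex.normSq_eq_norm_sq, ← Complex.mul_conj]
    simp [mulVec, dotProduct]
  rw [Complex.ofReal_mul, Complex.ofReal_prod]
  simp_rw [h, Finset.prod_mul_distrib, Fintype.prod_sum, Finset.sum_mul_sum, Finset.sum_mul,
    Finset.prod_mul_distrib]
  refine Finset.sum_congr rfl fun f _ ↦ Finset.sum_congr rfl fun g _ ↦ ?_
  ring

theorem integrable_prod_norm_sq_mul_density (V : Matrix ι κ ℂ) :
    Integrable fun z : κ → ℂ ↦ (∏ i, ‖(V *ᵥ z) i‖ ^ 2) * density z := by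
  classical
  have h : Integrable fun z : κ → ℂ ↦ (((∏ i, ‖(V *ᵥ z) i‖ ^ 2) * density z : ℝ) : ℂ) := by
    simp_rw [prod_norm_sq_mul_density_eq]
    exact integrable_finsetSum _ fun f _ ↦ integrable_finsetSum _ fun g _ ↦
      (integrable_monomial_mul_density f g).const_mul _
  exact h.re

/-- **Wick's formula** for the moments of the squared moduli of linear forms. -/
theorem integral_prod_norm_sq_mul_density [DecidableEq ι] (V : Matrix ι κ ℂ) :
    ((∫ z : κ → ℂ, (∏ i, ‖(V *ᵥ z) i‖ ^ 2) * density z : ℝ) : ℂ) = (V * Vᴴ).permanent := by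
  classical
  rw [← integral_complex_ofReal]
  simp_rw [prod_norm_sq_mul_density_eq]
  rw [integral_finsetSum _ fun f _ ↦ integrable_finsetSum _ fun g _ ↦
    (integrable_monomial_mul_density f g).const_mul _, permanent_mul_conjTranspose]
  refine Finset.sum_congr rfl fun f _ ↦ ?_
  rw [integral_finsetSum _ fun g _ ↦ (integrable_monomial_mul_density f g).const_mul _]
  refine Finset.sum_congr rfl fun g _ ↦ ?_
  rw [integral_const_mul, integral_monomial_mul_density]

theorem integrable_density : Integrable (density : (κ → ℂ) → ℝ) := by
  simpa using integrable_prod_norm_sq_mul_density (0 : Matrix Empty κ ℂ)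

theorem integral_density : ∫ z : κ → ℂ, density z = 1 := by
  have := integral_prod_norm_sq_mul_density (0 : Matrix Empty κ ℂ)
  rw [permanent_isEmpty] at this
  exact_mod_cast (by simpa using this : ((∫ z : κ → ℂ, density z : ℝ) : ℂ) = 1)

theorem integrable_norm_sq_dotProduct_mul_density (u : κ → ℂ) :
    Integrable fun z : κ → ℂ ↦ ‖u ⬝ᵥ z‖ ^ 2 * density z := by
  simpa [mulVec] using integrable_prod_norm_sq_mul_density (of fun _ : Unit ↦ u)

theorem integral_norm_sq_dotProduct_mul_density (u : κ → ℂ) :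
    ∫ z : κ → ℂ, ‖u ⬝ᵥ z‖ ^ 2 * density z = ∑ k, ‖u k‖ ^ 2 := by
  have := integral_prod_norm_sq_mul_density (of fun _ : Unit ↦ u)
  rw [permanent_unique, mul_apply] at this
  rw [← Complex.ofReal_inj]
  simpa [mulVec, Complex.mul_conj, Complex.normSq_eq_norm_sq] using this

theorem measurableEmbedding_mulVec [DecidableEq κ] {M : Matrix κ κ ℂ} (hM : M.det ≠ 0) :
    MeasurableEmbedding fun w : κ → ℂ ↦ M *ᵥ w := by
  have hu : IsUnit M := (isUnit_iff_isUnit_det M).2 hM.isUnit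
  have hc : Continuous fun w : κ → ℂ ↦ M *ᵥ w := by fun_prop
  exact hc.measurableEmbedding (mulVec_injective_of_isUnit hu)

theorem map_mulVec_volume [DecidableEq κ] {M : Matrix κ κ ℂ} (hM : M.det ≠ 0) :
    Measure.map (fun w : κ → ℂ ↦ M *ᵥ w) volume =
      ENNReal.ofReal (‖M.det‖ ^ 2)⁻¹ • (volume : Measure (κ → ℂ)) := by
  have hdet : LinearMap.det ((toLin' M).restrictScalars ℝ) = ‖M.det‖ ^ 2 := by
    rw [LinearMap.det_restrictScalars, Algebra.norm_complex_eq, LinearMap.det_toLin']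
    exact Complex.normSq_eq_norm_sq _
  have h := Measure.map_linearMap_addHaar_eq_smul_addHaar (volume : Measure (κ → ℂ))
    (f := (toLin' M).restrictScalars ℝ) (by rw [hdet]; positivity)
  rw [hdet, abs_of_nonneg (by positivity)] at h
  exact h

theorem integrable_comp_mulVec [DecidableEq κ] {M : Matrix κ κ ℂ} (hM : M.det ≠ 0)
    {F : (κ → ℂ) → ℝ} (hF : Integrable F) : Integrable fun w ↦ F (M *ᵥ w) := by
  refine (measurableEmbedding_mulVec hM).integrable_map_iff.1 ?_
  rw [map_mulVec_volume hM]
  exact hF.smul_measure ENNReal.ofReal_ne_top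

theorem integral_comp_mulVec [DecidableEq κ] {M : Matrix κ κ ℂ} (hM : M.det ≠ 0)
    (F : (κ → ℂ) → ℝ) : ‖M.det‖ ^ 2 * ∫ w, F (M *ᵥ w) = ∫ z, F z := by
  rw [← (measurableEmbedding_mulVec hM).integral_map, map_mulVec_volume hM,
    integral_smul_measure, ENNReal.toReal_ofReal (by positivity), smul_eq_mul,
    mul_inv_cancel_left₀ (by positivity)]

theorem ae_dotProduct_ne_zero {u : κ → ℂ} (hu : u ≠ 0) : ∀ᵐ w : κ → ℂ, u ⬝ᵥ w ≠ 0 := by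
  classical
  have h := Measure.addHaar_submodule (volume : Measure (κ → ℂ))
    ((LinearMap.ker (dotProductBilin ℂ ℂ u)).restrictScalars ℝ) (by
      obtain ⟨k, hk⟩ := Function.ne_iff.1 hu
      intro htop
      have : Pi.single k (1 : ℂ) ∈
          (LinearMap.ker (dotProductBilin ℂ ℂ u)).restrictScalars ℝ := by
        rw [htop]; trivial
      exact hk (by simpa using this))
  rw [ae_iff]
  convert h using 2
  ext w
  simp

theorem log_mul_norm_sq_mul_pdf_ae_eq {c : ℝ} (hc : 0 < c) :
    (fun z : ℂ ↦ Real.log (c * ‖z‖ ^ 2) * pdf z) =ᵐ[volume]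
      fun z ↦ Real.log c * pdf z + Real.log (‖z‖ ^ 2) * pdf z := by
  filter_upwards [Measure.ae_ne volume (0 : ℂ)] with z hz
  rw [Real.log_mul hc.ne' (by positivity), add_mul]

theorem integrable_pdf : Integrable pdf := by
  simpa using integrable_norm_pow_mul_pdf 0

theorem integral_pdf : ∫ z : ℂ, pdf z = 1 := by
  simpa using integral_norm_sq_pow_mul_pdf 0

theorem integrable_log_mul_norm_sq_mul_pdf {c : ℝ} (hc : 0 < c) :
    Integrable fun z : ℂ ↦ Real.log (c * ‖z‖ ^ 2) * pdf z :=
  ((integrable_pdf.const_mul _).add integral_log_norm_sq_mul_pdf.1).congr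
    (log_mul_norm_sq_mul_pdf_ae_eq hc).symm

theorem integral_log_mul_norm_sq_mul_pdf {c : ℝ} (hc : 0 < c) :
    ∫ z : ℂ, Real.log (c * ‖z‖ ^ 2) * pdf z = Real.log c - Real.eulerMascheroniConstant := by
  rw [integral_congr_ae (log_mul_norm_sq_mul_pdf_ae_eq hc),
    integral_add (integrable_pdf.const_mul _) integral_log_norm_sq_mul_pdf.1,
    integral_const_mul, integral_pdf, integral_log_norm_sq_mul_pdf.2]
  ring

theorem mul_density_eq_prod_update [DecidableEq κ] (f : ℂ → ℝ) (k : κ) (z : κ → ℂ) :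
    f (z k) * density z = ∏ j, Function.update (fun _ ↦ pdf) k (fun x ↦ f x * pdf x) j (z j) := by
  rw [density, ← Finset.mul_prod_erase _ _ (Finset.mem_univ k),
    ← Finset.mul_prod_erase _
      (fun j ↦ Function.update (fun _ ↦ pdf) k (fun x ↦ f x * pdf x) j (z j)) (Finset.mem_univ k),
    Function.update_self, mul_assoc]
  congr 2
  refine Finset.prod_congr rfl fun j hj ↦ ?_
  rw [Function.update_of_ne (Finset.ne_of_mem_erase hj)]

theorem integrable_coordinate_mul_density {f : ℂ → ℝ} (hf : Integrable fun z ↦ f z * pdf z)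
    (k : κ) : Integrable fun z : κ → ℂ ↦ f (z k) * density z := by
  classical
  simp_rw [mul_density_eq_prod_update]
  refine Integrable.fintype_prod fun j ↦ ?_
  rcases eq_or_ne j k with rfl | hj
  · simpa using hf
  · simpa [hj] using integrable_pdf

theorem integral_coordinate_mul_density (f : ℂ → ℝ) (k : κ) :
    ∫ z : κ → ℂ, f (z k) * density z = ∫ x, f x * pdf x := by
  classical
  simp_rw [mul_density_eq_prod_update]
  rw [integral_fintype_prod_volume_eq_prod, Finset.prod_eq_single k]
  · simp
  · intro j _ hj
    simpa [hj] using integral_pdf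
  · simp

theorem sum_norm_sq_eq (w : κ → ℂ) : ((∑ k, ‖w k‖ ^ 2 : ℝ) : ℂ) = star w ⬝ᵥ w := by
  simp [dotProduct, mul_comm (conj _), Complex.mul_conj, Complex.normSq_eq_norm_sq]

theorem exists_mem_unitaryGroup_dotProduct_eq [DecidableEq κ] {u : κ → ℂ} (hu : u ≠ 0) :
    ∃ Q ∈ unitaryGroup κ ℂ, ∃ k, ∀ w : κ → ℂ,
      ‖u ⬝ᵥ w‖ ^ 2 = (∑ j, ‖u j‖ ^ 2) * ‖(Q *ᵥ w) k‖ ^ 2 := by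
  obtain ⟨k, -⟩ := Function.ne_iff.1 hu
  let x : EuclideanSpace ℂ κ := WithLp.toLp 2 (star u)
  have hx : x ≠ 0 := by simpa [x] using hu
  have hnorm : ‖x‖ ^ 2 = ∑ j, ‖u j‖ ^ 2 := by simp [x, EuclideanSpace.norm_sq_eq]
  obtain ⟨b, hb⟩ := Orthonormal.exists_orthonormalBasis_extension_of_card_eq (𝕜 := ℂ)
    (E := EuclideanSpace ℂ κ) (ι := κ) (by simp) (v := fun _ ↦ ((‖x‖⁻¹ : ℝ) : ℂ) • x) (s := {k})
    (by
      refine ⟨fun _ ↦ ?_, fun i j hij ↦ absurd (Subsingleton.elim i j) hij⟩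
      simpa [Set.domRestrict] using norm_smul_inv_norm (𝕜 := ℂ) hx)
  have hU := (EuclideanSpace.basisFun κ ℂ).toMatrix_orthonormalBasis_mem_unitary b
  refine ⟨_, Unitary.star_mem hU, k, fun w ↦ ?_⟩
  have hQ : (star ((EuclideanSpace.basisFun κ ℂ).toBasis.toMatrix b) *ᵥ w) k =
      ((‖x‖⁻¹ : ℝ) : ℂ) * (u ⬝ᵥ w) := by
    have := hb k rfl
    simp [mulVec, dotProduct, Module.Basis.toMatrix_apply, this, x,
      Finset.mul_sum, mul_assoc]
  have hn : ‖x‖ ≠ 0 := norm_ne_zero_iff.2 hx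
  rw [hQ, ← hnorm, norm_mul, Complex.norm_real]
  simp only [norm_inv, norm_norm]
  field_simp

theorem density_unitary_mulVec [DecidableEq κ] {Q : Matrix κ κ ℂ} (hQ : Q ∈ unitaryGroup κ ℂ)
    (w : κ → ℂ) : density (Q *ᵥ w) = density w := by
  have h : ∑ k, ‖(Q *ᵥ w) k‖ ^ 2 = ∑ k, ‖w k‖ ^ 2 := by
    rw [← Complex.ofReal_inj, sum_norm_sq_eq, sum_norm_sq_eq, star_mulVec, ← dotProduct_mulVec,
      mulVec_mulVec, ← star_eq_conjTranspose, mem_unitaryGroup_iff'.1 hQ, one_mulVec]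
  rw [density_eq, density_eq, h]

theorem integral_log_norm_sq_dotProduct_mul_density {u : κ → ℂ} (hu : u ≠ 0) :
    Integrable (fun w : κ → ℂ ↦ Real.log (‖u ⬝ᵥ w‖ ^ 2) * density w) ∧
      ∫ w : κ → ℂ, Real.log (‖u ⬝ᵥ w‖ ^ 2) * density w =
        Real.log (∑ k, ‖u k‖ ^ 2) - Real.eulerMascheroniConstant := by
  classical
  obtain ⟨Q, hQ, k, hk⟩ := exists_mem_unitaryGroup_dotProduct_eq hu
  have hc : 0 < ∑ k, ‖u k‖ ^ 2 := by
    obtain ⟨j, hj⟩ := Function.ne_iff.1 hu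
    exact Finset.sum_pos' (fun _ _ ↦ by positivity)
      ⟨j, Finset.mem_univ j, by have : u j ≠ 0 := hj; positivity⟩
  have hdet : ‖Q.det‖ = 1 := by
    have := det_of_mem_unitary hQ
    exact CStarRing.norm_of_mem_unitary this
  have hdet0 : Q.det ≠ 0 := norm_ne_zero_iff.1 (by simp [hdet])
  set F : (κ → ℂ) → ℝ := fun z ↦ Real.log ((∑ j, ‖u j‖ ^ 2) * ‖z k‖ ^ 2) * density z with hFdef
  have hF : (fun w : κ → ℂ ↦ Real.log (‖u ⬝ᵥ w‖ ^ 2) * density w) = fun w ↦ F (Q *ᵥ w) := by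
    ext w
    simp only [F, hk w, density_unitary_mulVec hQ]
  rw [hF]
  refine ⟨integrable_comp_mulVec hdet0
    (integrable_coordinate_mul_density (integrable_log_mul_norm_sq_mul_pdf hc) k), ?_⟩
  have h := integral_comp_mulVec hdet0 F
  rw [hdet, one_pow, one_mul] at h
  rw [h, hFdef,
    integral_coordinate_mul_density (fun x : ℂ ↦ Real.log ((∑ j, ‖u j‖ ^ 2) * ‖x‖ ^ 2)) k,
    integral_log_mul_norm_sq_mul_pdf hc]

theorem density_mulVec (M : Matrix κ κ ℂ) (w : κ → ℂ) :
    density (M *ᵥ w) =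
      Real.exp (∑ k, ‖w k‖ ^ 2 - ∑ k, ‖(M *ᵥ w) k‖ ^ 2) * density w := by
  rw [density_eq, density_eq, mul_left_comm, ← Real.exp_add]
  ring_nf

theorem integrable_sum_norm_sq_mulVec_mul_density (M : Matrix κ κ ℂ) :
    Integrable fun w : κ → ℂ ↦ (∑ k, ‖(M *ᵥ w) k‖ ^ 2) * density w := by
  simp_rw [Finset.sum_mul]
  exact integrable_finsetSum _ fun k _ ↦ integrable_norm_sq_dotProduct_mul_density (M k)

theorem integral_sum_norm_sq_mulVec_mul_density (M : Matrix κ κ ℂ) :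
    ∫ w : κ → ℂ, (∑ k, ‖(M *ᵥ w) k‖ ^ 2) * density w = ∑ k, ∑ l, ‖M k l‖ ^ 2 := by
  have hi : ∀ k, Integrable fun w : κ → ℂ ↦ ‖(M *ᵥ w) k‖ ^ 2 * density w :=
    fun k ↦ integrable_norm_sq_dotProduct_mul_density (M k)
  simp_rw [Finset.sum_mul]
  rw [integral_finsetSum _ fun k _ ↦ hi k]
  exact Finset.sum_congr rfl fun k _ ↦ integral_norm_sq_dotProduct_mul_density (M k)

/-- Jensen's inequality for the exponential function and a probability density. -/
theorem exp_integral_le_of_ae_le {α : Type*} [MeasurableSpace α] {μ : Measure α}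
    {p Y G : α → ℝ} (hp : Integrable p μ) (hp1 : ∫ x, p x ∂μ = 1) (hp0 : ∀ x, 0 ≤ p x)
    (hY : Integrable (fun x ↦ Y x * p x) μ) (hG : Integrable G μ)
    (h : ∀ᵐ x ∂μ, Real.exp (Y x) * p x ≤ G x) :
    Real.exp (∫ x, Y x * p x ∂μ) ≤ ∫ x, G x ∂μ := by
  set m := ∫ x, Y x * p x ∂μ with hm
  have hint : Integrable (fun x ↦ Real.exp m * ((1 - m) * p x + Y x * p x)) μ :=
    ((hp.const_mul _).add hY).const_mul _
  calc Real.exp m = ∫ x, Real.exp m * ((1 - m) * p x + Y x * p x) ∂μ := by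
        rw [integral_const_mul, integral_add (hp.const_mul _) hY, integral_const_mul, hp1, ← hm]
        ring
    _ ≤ ∫ x, G x ∂μ := by
        refine integral_mono_ae hint hG ?_
        filter_upwards [h] with x hx
        refine le_trans ?_ hx
        have h1 : Real.exp m * (Y x - m + 1) ≤ Real.exp (Y x) := by
          calc Real.exp m * (Y x - m + 1) ≤ Real.exp m * Real.exp (Y x - m) := by
                gcongr
                exact Real.add_one_le_exp _
            _ = Real.exp (Y x) := by rw [← Real.exp_add]; ring_nf
        calc Real.exp m * ((1 - m) * p x + Y x * p x)
            = Real.exp m * (Y x - m + 1) * p x := by ring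
          _ ≤ Real.exp (Y x) * p x := mul_le_mul_of_nonneg_right h1 (hp0 x)

theorem exp_le_integral_prod_norm_sq_mul_density [DecidableEq κ] (V : Matrix ι κ ℂ)
    (hV : ∀ i, V i ≠ 0) {M : Matrix κ κ ℂ} (hM : M.det ≠ 0) :
    Real.exp (∑ i, Real.log (∑ k, ‖(V * M) i k‖ ^ 2) + Real.log (‖M.det‖ ^ 2)
        - ∑ k, ∑ l, ‖M k l‖ ^ 2 + Fintype.card κ
        - Real.eulerMascheroniConstant * Fintype.card ι) ≤
      ∫ z : κ → ℂ, (∏ i, ‖(V *ᵥ z) i‖ ^ 2) * density z := by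
  have hVM : ∀ i, (V * M) i ≠ 0 := by
    intro i h
    refine hV i (vecMul_injective_of_isUnit ((isUnit_iff_isUnit_det M).2 hM.isUnit) ?_)
    simpa [mul_apply_eq_vecMul] using h
  set Y : (κ → ℂ) → ℝ := fun w ↦ ∑ i, Real.log (‖(V * M) i ⬝ᵥ w‖ ^ 2) +
    (∑ k, ‖((1 : Matrix κ κ ℂ) *ᵥ w) k‖ ^ 2 - ∑ k, ‖(M *ᵥ w) k‖ ^ 2) with hYdef
  have hlog i := integral_log_norm_sq_dotProduct_mul_density (hVM i)
  have hI₁ : Integrable fun w : κ → ℂ ↦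
      ∑ i, Real.log (‖(V * M) i ⬝ᵥ w‖ ^ 2) * density w :=
    integrable_finsetSum _ fun i _ ↦ (hlog i).1
  have hI₂ := integrable_sum_norm_sq_mulVec_mul_density (1 : Matrix κ κ ℂ)
  have hI₃ := integrable_sum_norm_sq_mulVec_mul_density M
  have hI₂₃ : Integrable fun w : κ → ℂ ↦ (∑ k, ‖((1 : Matrix κ κ ℂ) *ᵥ w) k‖ ^ 2) * density w -
      (∑ k, ‖(M *ᵥ w) k‖ ^ 2) * density w := hI₂.sub hI₃
  have hY : (fun w ↦ Y w * density w) = fun w ↦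
      (∑ i, Real.log (‖(V * M) i ⬝ᵥ w‖ ^ 2) * density w) +
        ((∑ k, ‖((1 : Matrix κ κ ℂ) *ᵥ w) k‖ ^ 2) * density w -
          (∑ k, ‖(M *ᵥ w) k‖ ^ 2) * density w) := by
    ext w
    rw [← Finset.sum_mul, ← sub_mul, ← add_mul]
  have hYi : Integrable fun w ↦ Y w * density w := by
    rw [hY]
    exact hI₁.add hI₂₃
  have hYint : ∫ w, Y w * density w = ∑ i, Real.log (∑ k, ‖(V * M) i k‖ ^ 2)
      - ∑ k, ∑ l, ‖M k l‖ ^ 2 + Fintype.card κ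
      - Real.eulerMascheroniConstant * Fintype.card ι := by
    rw [hY, integral_add hI₁ hI₂₃, integral_sub hI₂ hI₃,
      integral_finsetSum _ fun i _ ↦ (hlog i).1, integral_sum_norm_sq_mulVec_mul_density,
      integral_sum_norm_sq_mulVec_mul_density]
    have h1 : ∑ k, ∑ l, ‖(1 : Matrix κ κ ℂ) k l‖ ^ 2 = Fintype.card κ := by
      simp [one_apply, apply_ite norm, ite_pow]
    simp_rw [fun i ↦ (hlog i).2, h1, Finset.sum_sub_distrib]
    simp
    ring
  have hG := integrable_comp_mulVec hM (integrable_prod_norm_sq_mul_density V)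
  have hle := exp_integral_le_of_ae_le integrable_density integral_density density_nonneg hYi hG (by
    have hne : ∀ᵐ w : κ → ℂ, ∀ i, (V * M) i ⬝ᵥ w ≠ 0 :=
      ae_all_iff.2 fun i ↦ ae_dotProduct_ne_zero (hVM i)
    filter_upwards [hne] with w hw
    refine le_of_eq ?_
    have hprod : ∏ i, ‖(V *ᵥ (M *ᵥ w)) i‖ ^ 2 =
        Real.exp (∑ i, Real.log (‖(V * M) i ⬝ᵥ w‖ ^ 2)) := by
      rw [Real.exp_sum, mulVec_mulVec]
      refine Finset.prod_congr rfl fun i _ ↦ ?_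
      have := hw i
      rw [Real.exp_log (by positivity)]
      rfl
    rw [hprod, density_mulVec, ← mul_assoc, ← Real.exp_add, hYdef]
    simp)
  rw [← integral_comp_mulVec hM]
  have hd : 0 < ‖M.det‖ ^ 2 := by positivity
  calc _ = ‖M.det‖ ^ 2 * Real.exp (∫ w, Y w * density w) := by
        rw [hYint]
        nth_rewrite 2 [← Real.exp_log hd]
        rw [← Real.exp_add]
        ring_nf
    _ ≤ _ := by gcongr

end ComplexGaussian

open scoped MatrixOrder in
theorem Matrix.PosDef.exists_eq_mul_conjTranspose {κ : Type*} [Fintype κ] [DecidableEq κ]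
    {X : Matrix κ κ ℂ} (hX : X.PosDef) : ∃ B : Matrix κ κ ℂ, B.det ≠ 0 ∧ X = Bᴴ * B := by
  obtain ⟨B, rfl⟩ := CStarAlgebra.nonneg_iff_eq_star_mul_self.mp hX.posSemidef.nonneg
  refine ⟨B, fun h ↦ hX.det_pos.ne' ?_, rfl⟩
  rw [det_mul, h, mul_zero]

theorem stmt2 {n d : ℕ} (A : Matrix (Fin n) (Fin n) ℂ) (V : Matrix (Fin n) (Fin d) ℂ)
    (hfact : A = V * Vᴴ) (hV : V.rank = d) (hrows : ∀ i, V i ≠ 0)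
    (X : Matrix (Fin d) (Fin d) ℂ) (hX : X.PosDef) :
    (Real.exp ((∑ i, Real.log ((star (V i) ⬝ᵥ X *ᵥ V i).re))
        + Real.log X.det.re - X.trace.re + d
        - Real.eulerMascheroniConstant * n) : ℂ) ≤ A.permanent := by
  obtain ⟨B, hB, rfl⟩ := hX.exists_eq_mul_conjTranspose
  subst hfact
  have h := ComplexGaussian.exp_le_integral_prod_norm_sq_mul_density V hrows (M := Bᵀ)
    (by rwa [det_transpose])
  rw [← ComplexGaussian.integral_prod_norm_sq_mul_density, Complex.real_le_real]
  convert h using 2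
  have h1 : ∀ i, (star (V i) ⬝ᵥ (Bᴴ * B) *ᵥ V i).re = ∑ k, ‖(V * Bᵀ) i k‖ ^ 2 := by
    intro i
    have hrow : (V * Bᵀ) i = B *ᵥ V i := by
      rw [mul_apply_eq_vecMul, vecMul_transpose]
    rw [hrow, ← mulVec_mulVec, dotProduct_mulVec, ← star_mulVec,
      ← ComplexGaussian.sum_norm_sq_eq, Complex.ofReal_re]
  have h2 : (Bᴴ * B).det.re = ‖Bᵀ.det‖ ^ 2 := by
    rw [det_mul, det_conjTranspose, det_transpose, mul_comm, Complex.star_def, Complex.mul_conj,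
      Complex.normSq_eq_norm_sq, Complex.ofReal_re]
  have h3 : (Bᴴ * B).trace.re = ∑ k, ∑ l, ‖Bᵀ k l‖ ^ 2 := by
    simp only [trace, diag_apply, mul_apply, conjTranspose_apply, transpose_apply,
      Complex.re_sum, Complex.star_def]
    simp_rw [mul_comm (starRingEnd ℂ _), Complex.mul_conj, Complex.normSq_eq_norm_sq,
      Complex.ofReal_re]
  simp_rw [h1, h2, h3, Fintype.card_fin]
end
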